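/- arXiv:1303.4091 — 3 statements merged into one kernel-verified Lean document; each statement's English description precedes it below -/
import Mathlib

section
/- Let Γ be a graph satisfying the d-dimensional isoperimetric profile IS_d and 1 ≤ p < d/2. For g ∈ D^p(Γ), let g̃ be its boundary value for the simple random walk, g̃(x) = lim_{n→∞} ∑_y P^{(n)}_x(y) g(y). Then for every q > dp/(d−2p), the difference g̃ − g belongs to ℓ^q(X); in particular g̃ ∈ D^q(Γ) and g̃ and g define the same class in the unreduced ℓ^q-cohomology in degree one, D^q(Γ)/(ℓ^q(X)+ℝ·1). -/
open scoped BigOperators ENNReal NNReal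
open Filter Topology

/-- `f` is `p`-summable (`f ∈ ℓ^p`), for a real exponent `0 < p < ∞`. -/
def lpMem {ι : Type*} (p : ℝ) (f : ι → ℝ) : Prop := Summable fun i => |f i| ^ p

/-- The `ℓ^q`-norm with exponent `q ∈ [1,∞]`, valued in `ℝ≥0∞`. -/
noncomputable def lpENorm {ι : Type*} (q : ℝ≥0∞) (f : ι → ℝ) : ℝ≥0∞ :=
  if q = ⊤ then ⨆ i, (‖f i‖₊ : ℝ≥0∞)
  else (∑' i, (‖f i‖₊ : ℝ≥0∞) ^ q.toReal) ^ (1 / q.toReal)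

/-- A bounded real-valued function. -/
def BoundedFun {ι : Type*} (f : ι → ℝ) : Prop := ∃ M : ℝ, ∀ i, |f i| ≤ M

/-- A graph of bounded (locally finite) valency: each vertex has a finite
set of neighbours, the adjacency is symmetric and there are no loops. -/
structure LFGraph (X : Type*) where
  nbr : X → Finset X
  symm : ∀ x y : X, y ∈ nbr x ↔ x ∈ nbr y
  loopless : ∀ x : X, x ∉ nbr x

namespace LFGraph

variable {X : Type*}

/-- Adjacency. -/
def Adj (G : LFGraph X) (x y : X) : Prop := y ∈ G.nbr x

/-- Connectivity of the graph. -/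
def Conn (G : LFGraph X) : Prop := ∀ x y : X, Relation.ReflTransGen G.Adj x y

/-- The valency is bounded by `D`. -/
def BddVal (G : LFGraph X) (D : ℕ) : Prop := ∀ x : X, (G.nbr x).card ≤ D

/-- The set of oriented edges. -/
abbrev Edge (G : LFGraph X) : Type _ := {e : X × X // e.2 ∈ G.nbr e.1}

/-- The gradient `∇g(x,y) = g(y) - g(x)` of a function on the vertices,
as a function on oriented edges. -/
def grad (G : LFGraph X) (g : X → ℝ) (e : G.Edge) : ℝ := g e.1.2 - g e.1.1

/-- `g ∈ D^p(Γ)`: the gradient of `g` is in `ℓ^p(E)` (`p` finite). -/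
def MemDp (G : LFGraph X) (p : ℝ) (g : X → ℝ) : Prop := lpMem p (G.grad g)

/-- The `ℓ^p(E)`-norm of the gradient of `g`. -/
noncomputable def gradNorm (G : LFGraph X) (p : ℝ) (g : X → ℝ) : ℝ :=
  (∑' e : G.Edge, |G.grad g e| ^ p) ^ (1 / p)

/-- The `D^p`-distance between `g` and `h`, with basepoint `e0`:
`‖∇(g-h)‖_{ℓ^p(E)} + |g(e0) - h(e0)|`. -/
noncomputable def dpDist (G : LFGraph X) (p : ℝ) (e0 : X) (g h : X → ℝ) : ℝ :=
  G.gradNorm p (fun x => g x - h x) + |g e0 - h e0|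

/-- `g` belongs to the `D^p`-closure of `ℓ^p(X) + ℝ·1`, i.e. the class of `g`
in the degree one reduced `ℓ^p`-cohomology is trivial. -/
def InClos (G : LFGraph X) (p : ℝ) (e0 : X) (g : X → ℝ) : Prop :=
  ∀ ε : ℝ, 0 < ε → ∃ (f : X → ℝ) (c : ℝ), lpMem p f ∧
    G.MemDp p (fun x => g x - (f x + c)) ∧
    G.dpDist p e0 g (fun x => f x + c) < ε

/-- `g` belongs to the `D^p`-closure of `ℓ^p(X)` (no constants). -/
def InClosLp (G : LFGraph X) (p : ℝ) (e0 : X) (g : X → ℝ) : Prop :=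
  ∀ ε : ℝ, 0 < ε → ∃ f : X → ℝ, lpMem p f ∧
    G.MemDp p (fun x => g x - f x) ∧
    G.dpDist p e0 g f < ε

open Classical in
/-- The number of (oriented) boundary edges of a finite set `A` of vertices. -/
noncomputable def bdry (G : LFGraph X) (A : Finset X) : ℕ :=
  ∑ x ∈ A, ((G.nbr x).filter fun y => y ∉ A).card

/-- The `d`-dimensional isoperimetric profile `IS_d`. -/
def ISdim (G : LFGraph X) (d : ℝ) : Prop :=
  ∃ κ : ℝ, 0 < κ ∧ ∀ A : Finset X, A.Nonempty →
    (A.card : ℝ) ^ (1 - 1 / d) ≤ κ * (G.bdry A : ℝ)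

/-- The strong isoperimetric profile `IS_ω`. -/
def ISomega (G : LFGraph X) : Prop :=
  ∃ κ : ℝ, 0 < κ ∧ ∀ A : Finset X, A.Nonempty →
    (A.card : ℝ) ≤ κ * (G.bdry A : ℝ)

/-- `h` is harmonic: at every vertex, the average of `h` over the
neighbours equals the value of `h`. -/
def Harmonic (G : LFGraph X) (h : X → ℝ) : Prop :=
  ∀ x : X, ∑ y ∈ G.nbr x, h y = ((G.nbr x).card : ℝ) * h x

/-- The graph is Liouville: every bounded harmonic function is constant. -/
def Liouville (G : LFGraph X) : Prop :=
  ∀ h : X → ℝ, G.Harmonic h → BoundedFun h → ∀ x y : X, h x = h y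

open Classical in
/-- `walk G n x y` is the probability `P^{(n)}_x(y)` that the simple random
walk started at `x` is at `y` at time `n`. -/
noncomputable def walk (G : LFGraph X) : ℕ → X → X → ℝ
  | 0, x, y => if y = x then 1 else 0
  | n + 1, x, y => (∑ z ∈ G.nbr x, walk G n z y) / ((G.nbr x).card : ℝ)

/-- `avg G n g x = ∑_y P^{(n)}_x(y) g(y)`, the expected value of `g` after `n`
steps of the simple random walk started at `x`. -/
noncomputable def avg (G : LFGraph X) (n : ℕ) (g : X → ℝ) (x : X) : ℝ :=
  ∑' y, G.walk n x y * g y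

/-- The Markov operator of the simple random walk: average over the neighbours. -/
noncomputable def pAvg (G : LFGraph X) (f : X → ℝ) (x : X) : ℝ :=
  (∑ y ∈ G.nbr x, f y) / ((G.nbr x).card : ℝ)

/-- Reachability in exactly `n` steps. -/
def reachN (G : LFGraph X) : ℕ → X → X → Prop
  | 0, x, y => y = x
  | n + 1, x, y => ∃ z ∈ G.nbr x, reachN G n z y

/-- The graph distance (the smallest `n` such that `y` is reachable from `x`
in `n` steps). -/
noncomputable def gdist (G : LFGraph X) (x y : X) : ℕ :=
  sInf {n : ℕ | G.reachN n x y}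

/-- `f` is a quasi-isometry between the connected graphs `G` and `H`. -/
def QI {X Y : Type*} (G : LFGraph X) (H : LFGraph Y) (f : X → Y) : Prop :=
  G.Conn ∧ H.Conn ∧ ∃ Λ C : ℝ, 1 ≤ Λ ∧ 0 ≤ C ∧
    (∀ x x' : X, (H.gdist (f x) (f x') : ℝ) ≤ Λ * (G.gdist x x') + C) ∧
    (∀ x x' : X, (G.gdist x x' : ℝ) ≤ Λ * (H.gdist (f x) (f x')) + C) ∧
    ∀ y : Y, ∃ x : X, (H.gdist (f x) y : ℝ) ≤ C

/-- Reachability avoiding the finite set `F`. -/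
def reachAvoid (G : LFGraph X) (F : Finset X) : X → X → Prop :=
  Relation.ReflTransGen fun a b => b ∈ G.nbr a ∧ a ∉ F ∧ b ∉ F

/-- The graph has at most one end: for every finite set `F` of vertices,
the complement of `F` has at most one infinite connected component. -/
def AtMostOneEnd (G : LFGraph X) : Prop :=
  ∀ F : Finset X, ∀ x y : X, x ∉ F → y ∉ F →
    {z | G.reachAvoid F x z}.Infinite → {z | G.reachAvoid F y z}.Infinite →
    G.reachAvoid F x y

end LFGraph

/-- The Cayley graph of a group with respect to a finite symmetric generating
set `S` not containing the identity: the neighbours of `x` are the `s * x`, `s ∈ S`. -/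
def cayley {Γ : Type*} [Group Γ] [DecidableEq Γ] (S : Finset Γ)
    (hsym : ∀ s ∈ S, s⁻¹ ∈ S) (h1 : (1 : Γ) ∉ S) : LFGraph Γ where
  nbr x := S.image fun s => s * x
  symm := by
    intro x y
    simp only [Finset.mem_image]
    constructor
    · rintro ⟨s, hs, rfl⟩
      exact ⟨s⁻¹, hsym s hs, by group⟩
    · rintro ⟨s, hs, rfl⟩
      exact ⟨s⁻¹, hsym s hs, by group⟩
  loopless := by
    intro x hx
    rw [Finset.mem_image] at hx
    obtain ⟨s, hs, hsx⟩ := hx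
    have hs1 : s = 1 := by
      have h' : s * x = 1 * x := by rw [one_mul]; exact hsx
      exact mul_right_cancel h'
    exact h1 (hs1 ▸ hs)

/-- The ball of radius `n` in the word metric given by `S`. -/
def cball {Γ : Type*} [Group Γ] [DecidableEq Γ] (S : Finset Γ) : ℕ → Finset Γ
  | 0 => {1}
  | n + 1 => cball S n ∪ (cball S n).biUnion fun x => S.image fun s => s * x

/-- Amenability of a group, via the Følner condition. -/
def Amenable (Γ : Type*) [Group Γ] [DecidableEq Γ] : Prop :=
  ∀ (T : Finset Γ) (ε : ℝ), 0 < ε → ∃ F : Finset Γ, F.Nonempty ∧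
    ∀ t ∈ T, (((F.image fun x => t * x) \ F).card : ℝ) ≤ ε * (F.card : ℝ)
/-- Sequences with `a (n+1) ≤ a n - c * a n ^ (1 + ε)` decay like `n ^ (-1/ε)`, uniformly. -/
theorem exists_decay_of_sub_rpow {M c ε : ℝ} (hM : 0 < M) (hc : 0 < c) (hε : 0 < ε) :
    ∃ C : ℝ, 0 < C ∧ ∀ a : ℕ → ℝ, (∀ n, 0 ≤ a n) → a 0 ≤ M →
      (∀ n, a (n + 1) ≤ a n - c * a n ^ (1 + ε)) →
      ∀ n : ℕ, a n ≤ C * ((n : ℝ) + 1) ^ (-(1 / ε)) := by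
  set δ := min (M ^ (-ε)) (ε * c) with hδ
  have hδ0 : 0 < δ := lt_min (by positivity) (by positivity)
  refine ⟨δ ^ (-(1 / ε)), by positivity, fun a ha h0 hstep n => ?_⟩
  have key : ∀ n : ℕ, 0 < a n → δ * ((n : ℝ) + 1) ≤ a n ^ (-ε) := by
    intro n
    induction n with
    | zero =>
      intro h
      calc δ * (((0 : ℕ) : ℝ) + 1) = δ := by simp
        _ ≤ M ^ (-ε) := min_le_left _ _
        _ ≤ a 0 ^ (-ε) := Real.rpow_le_rpow_of_nonpos h h0 (by linarith)
    | succ n ih =>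
      intro h
      have hpow : 0 ≤ c * a n ^ (1 + ε) := mul_nonneg hc.le (Real.rpow_nonneg (ha n) _)
      have hn : 0 < a n := by linarith [hstep n]
      have h1 : a (n + 1) ≤ a n * Real.exp (-(c * a n ^ ε)) := by
        have h2 := Real.add_one_le_exp (-(c * a n ^ ε))
        have h3 := hstep n
        rw [Real.rpow_add hn, Real.rpow_one] at h3
        nlinarith
      have h4 : (a n * Real.exp (-(c * a n ^ ε))) ^ (-ε) ≤ a (n + 1) ^ (-ε) :=
        Real.rpow_le_rpow_of_nonpos h h1 (by linarith)
      rw [Real.mul_rpow hn.le (Real.exp_pos _).le, ← Real.exp_mul] at h4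
      have h5 := Real.add_one_le_exp (-(c * a n ^ ε) * -ε)
      have h6 : a n ^ (-ε) * a n ^ ε = 1 := by
        rw [← Real.rpow_add hn]; simp
      have h7 : 0 < a n ^ (-ε) := by positivity
      have h8 : a n ^ (-ε) + ε * c ≤ a n ^ (-ε) * Real.exp (-(c * a n ^ ε) * -ε) := by
        calc a n ^ (-ε) + ε * c = a n ^ (-ε) + ε * c * (a n ^ (-ε) * a n ^ ε) := by rw [h6]; ring
          _ = a n ^ (-ε) * (-(c * a n ^ ε) * -ε + 1) := by ring
          _ ≤ _ := by gcongr
      have h9 : δ ≤ ε * c := min_le_right _ _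
      have := ih hn
      push_cast
      linarith
  rcases (ha n).eq_or_lt with h | h
  · rw [← h]; positivity
  · have h1 := key n h
    have h2 : (a n ^ (-ε)) ^ (-(1 / ε)) = a n := by
      rw [← Real.rpow_mul h.le]
      have : -ε * -(1 / ε) = 1 := by field_simp
      rw [this, Real.rpow_one]
    rw [← Real.mul_rpow hδ0.le (by positivity), ← h2]
    exact Real.rpow_le_rpow_of_nonpos (by positivity) h1 (by
      have : 0 < 1 / ε := by positivity
      linarith)

/-- Binomial means of a convergent sequence converge to the same limit. -/
theorem tendsto_binomial_mean {a : ℕ → ℝ} {l : ℝ} (ha : Tendsto a atTop (𝓝 l)) :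
    Tendsto (fun n => ∑ k ∈ Finset.range (n + 1), (n.choose k : ℝ) / 2 ^ n * a k) atTop (𝓝 l) := by
  have hsum : ∀ n : ℕ, ∑ k ∈ Finset.range (n + 1), (n.choose k : ℝ) / 2 ^ n = 1 := by
    intro n
    rw [← Finset.sum_div, ← Nat.cast_sum, Nat.sum_range_choose]
    simp
  rw [Metric.tendsto_atTop] at ha
  rw [Metric.tendsto_atTop]
  intro ε hε
  obtain ⟨N, hN⟩ := ha (ε / 2) (by positivity)
  have hlim : Tendsto (fun n : ℕ => ∑ k ∈ Finset.range N, (n : ℝ) ^ k / 2 ^ n * |a k - l|)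
      atTop (𝓝 0) := by
    have : Tendsto (fun n : ℕ => ∑ k ∈ Finset.range N, (n : ℝ) ^ k / 2 ^ n * |a k - l|)
        atTop (𝓝 (∑ k ∈ Finset.range N, 0 * |a k - l|)) :=
      tendsto_finsetSum _ fun k _ =>
        (tendsto_pow_const_div_const_pow_of_one_lt k one_lt_two).mul_const _
    simpa using this
  rw [Metric.tendsto_atTop] at hlim
  obtain ⟨N', hN'⟩ := hlim (ε / 2) (by positivity)
  refine ⟨N', fun n hn => ?_⟩
  have h1 := hN' n hn
  rw [Real.dist_eq, sub_zero] at h1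
  have h1' := (le_abs_self _).trans_lt h1
  have hdiff : (∑ k ∈ Finset.range (n + 1), (n.choose k : ℝ) / 2 ^ n * a k) - l
      = ∑ k ∈ Finset.range (n + 1), (n.choose k : ℝ) / 2 ^ n * (a k - l) := by
    simp_rw [mul_sub]
    rw [Finset.sum_sub_distrib, ← Finset.sum_mul, hsum, one_mul]
  rw [Real.dist_eq, hdiff]
  have hterm : ∀ k : ℕ, |(n.choose k : ℝ) / 2 ^ n * (a k - l)| ≤
      (n.choose k : ℝ) / 2 ^ n * (ε / 2) + if k < N then (n : ℝ) ^ k / 2 ^ n * |a k - l| else 0 := by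
    intro k
    have hc : (0 : ℝ) ≤ (n.choose k : ℝ) / 2 ^ n := by positivity
    rw [abs_mul, abs_of_nonneg hc]
    split_ifs with hk
    · have : (n.choose k : ℝ) / 2 ^ n ≤ (n : ℝ) ^ k / 2 ^ n := by
        gcongr
        exact_mod_cast Nat.choose_le_pow n k
      have h3 := mul_le_mul_of_nonneg_right this (abs_nonneg (a k - l))
      have : 0 ≤ (n.choose k : ℝ) / 2 ^ n * (ε / 2) := by positivity
      linarith
    · have h3 := hN k (not_lt.mp hk)
      rw [Real.dist_eq] at h3
      have := mul_le_mul_of_nonneg_left h3.le hc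
      linarith
  have hindic : ∑ k ∈ Finset.range (n + 1),
      (if k < N then (n : ℝ) ^ k / 2 ^ n * |a k - l| else 0) ≤
      ∑ k ∈ Finset.range N, (n : ℝ) ^ k / 2 ^ n * |a k - l| := by
    rw [← Finset.sum_filter]
    refine Finset.sum_le_sum_of_subset_of_nonneg ?_ fun _ _ _ => by positivity
    intro k hk
    simpa using (Finset.mem_filter.mp hk).2
  calc |∑ k ∈ Finset.range (n + 1), (n.choose k : ℝ) / 2 ^ n * (a k - l)|
      ≤ ∑ k ∈ Finset.range (n + 1), |(n.choose k : ℝ) / 2 ^ n * (a k - l)| :=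
        Finset.abs_sum_le_sum_abs _ _
    _ ≤ ∑ k ∈ Finset.range (n + 1), ((n.choose k : ℝ) / 2 ^ n * (ε / 2) +
          if k < N then (n : ℝ) ^ k / 2 ^ n * |a k - l| else 0) :=
        Finset.sum_le_sum fun k _ => hterm k
    _ < ε := by
        rw [Finset.sum_add_distrib, ← Finset.sum_mul, hsum]
        linarith

/-- A pointwise convergent series whose terms have summable `ℓ^q`-norms has its sum in `ℓ^q`. -/
theorem lpMem_of_tendsto_sum {ι : Type*} {q : ℝ} (hq : 1 ≤ q) {h : ℕ → ι → ℝ} {B : ℕ → ℝ}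
    (hB : ∀ k, 0 ≤ B k) (hBs : Summable B)
    (hh : ∀ k (S : Finset ι), ∑ i ∈ S, |h k i| ^ q ≤ B k ^ q) {w : ι → ℝ}
    (hw : ∀ i, Tendsto (fun N => ∑ k ∈ Finset.range N, h k i) atTop (𝓝 (w i))) :
    lpMem q w := by
  have hq0 : 0 < q := by linarith
  have hfin : ∀ (S : Finset ι) (N : ℕ),
      (∑ i ∈ S, |∑ k ∈ Finset.range N, h k i| ^ q) ^ (1 / q) ≤ ∑ k ∈ Finset.range N, B k := by
    intro S N
    induction N with
    | zero =>
      have : (0 : ℝ) ^ q = 0 := Real.zero_rpow hq0.ne'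
      have h2 : (0 : ℝ) ^ (1 / q) = 0 := Real.zero_rpow (by positivity)
      simp only [Finset.range_zero, Finset.sum_empty, abs_zero, this, Finset.sum_const_zero, h2,
        le_refl]
    | succ N ih =>
      simp_rw [Finset.sum_range_succ]
      refine (Real.Lp_add_le S _ _ hq).trans (add_le_add ih ?_)
      calc (∑ i ∈ S, |h N i| ^ q) ^ (1 / q) ≤ (B N ^ q) ^ (1 / q) :=
            Real.rpow_le_rpow (Finset.sum_nonneg fun _ _ => by positivity) (hh N S) (by positivity)
        _ = B N := by rw [← Real.rpow_mul (hB N), mul_one_div_cancel hq0.ne', Real.rpow_one]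
  refine summable_of_sum_le (c := (∑' k, B k) ^ q) (fun i => by positivity) fun S => ?_
  have hlim : Tendsto (fun N => ∑ i ∈ S, |∑ k ∈ Finset.range N, h k i| ^ q) atTop
      (𝓝 (∑ i ∈ S, |w i| ^ q)) :=
    tendsto_finsetSum _ fun i _ => ((hw i).abs).rpow_const (Or.inr hq0.le)
  refine le_of_tendsto' hlim fun N => ?_
  have h0 : 0 ≤ ∑ i ∈ S, |∑ k ∈ Finset.range N, h k i| ^ q :=
    Finset.sum_nonneg fun _ _ => by positivity
  have h1 := (hfin S N).trans (hBs.sum_le_tsum _ fun k _ => hB k)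
  have h2 := Real.rpow_le_rpow (by positivity) h1 hq0.le
  rwa [← Real.rpow_mul h0, one_div_mul_cancel hq0.ne', Real.rpow_one] at h2

theorem lpMem.of_le {ι : Type*} {p q : ℝ} {f : ι → ℝ} (hp : 0 < p) (hpq : p ≤ q)
    (hf : lpMem p f) : lpMem q f := by
  unfold lpMem at *
  have h1 : ∀ᶠ i in cofinite, |f i| ^ p < 1 :=
    hf.tendsto_cofinite_zero.eventually (gt_mem_nhds one_pos)
  refine Summable.of_norm_bounded_eventually hf ?_
  filter_upwards [h1] with i hi
  have h2 : |f i| ≤ 1 := by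
    by_contra! h
    exact absurd hi (not_lt.mpr (Real.one_le_rpow h.le hp.le))
  rw [Real.norm_of_nonneg (by positivity)]
  rcases (abs_nonneg (f i)).eq_or_lt with h | h
  · rw [← h, Real.zero_rpow hp.ne', Real.zero_rpow (by linarith)]
  · exact Real.rpow_le_rpow_of_exponent_ge h h2 hpq

theorem abs_add_rpow_le {p : ℝ} (hp : 1 ≤ p) (a b : ℝ) :
    |a + b| ^ p ≤ 2 ^ p * ((|a| ^ p + |b| ^ p) / 2) := by
  have h := (convexOn_rpow hp).2 (Set.mem_Ici.mpr (abs_nonneg a)) (Set.mem_Ici.mpr (abs_nonneg b))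
    (by norm_num : (0 : ℝ) ≤ 1 / 2) (by norm_num : (0 : ℝ) ≤ 1 / 2) (by norm_num)
  simp only [smul_eq_mul] at h
  calc |a + b| ^ p ≤ (|a| + |b|) ^ p :=
        Real.rpow_le_rpow (abs_nonneg _) (abs_add_le a b) (by linarith)
    _ = (2 * (1 / 2 * |a| + 1 / 2 * |b|)) ^ p := by ring_nf
    _ = 2 ^ p * (1 / 2 * |a| + 1 / 2 * |b|) ^ p := Real.mul_rpow (by norm_num) (by positivity)
    _ ≤ 2 ^ p * ((|a| ^ p + |b| ^ p) / 2) := by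
        gcongr
        linarith

theorem lpMem.add {ι : Type*} {p : ℝ} (hp : 1 ≤ p) {f g : ι → ℝ} (hf : lpMem p f)
    (hg : lpMem p g) : lpMem p (fun i => f i + g i) :=
  Summable.of_nonneg_of_le (fun i => by positivity) (fun i => abs_add_rpow_le hp (f i) (g i))
    (((Summable.add hf hg).div_const 2).mul_left _)

namespace LFGraph

variable {X : Type*} {G : LFGraph X}

/-- Discrete coarea inequality for functions supported in `A`. -/
theorem coarea_le {K : ℝ} {A₀ : Finset X}
    (hK : ∀ A : Finset X, A ⊆ A₀ → (A.card : ℝ) ≤ K * G.bdry A) :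
    ∀ A : Finset X, A ⊆ A₀ → ∀ f : X → ℝ, (∀ x, 0 ≤ f x) → (∀ x, x ∉ A → f x = 0) →
      ∑ x ∈ A, f x ≤ K * ∑ x ∈ A, ∑ y ∈ G.nbr x, max (f x - f y) 0 := by
  classical
  intro A
  induction A using Finset.strongInduction with
  | H A ih =>
  intro hA f hf hfA
  rcases A.eq_empty_or_nonempty with rfl | hne
  · simp
  obtain ⟨x₀, hx₀, hmin⟩ := A.exists_min_image f hne
  set m := f x₀ with hm
  set f' : X → ℝ := fun x => if x ∈ A then f x - m else 0 with hf'
  have hf'A : ∀ x ∈ A, f' x = f x - m := fun x hx => by simp [hf', hx]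
  have hf'0 : ∀ x, x ∉ A → f' x = 0 := fun x hx => by simp [hf', hx]
  have hf'x₀ : f' x₀ = 0 := by rw [hf'A _ hx₀, hm, sub_self]
  have hf'nn : ∀ x, 0 ≤ f' x := by
    intro x
    by_cases hx : x ∈ A
    · rw [hf'A x hx]; linarith [hmin x hx]
    · rw [hf'0 x hx]
  have hih := ih (A.erase x₀) (Finset.erase_ssubset hx₀) ((Finset.erase_subset _ _).trans hA) f'
    hf'nn (fun x hx => by
      by_cases hxA : x ∈ A
      · have : x = x₀ := by
          by_contra h
          exact hx (Finset.mem_erase.mpr ⟨h, hxA⟩)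
        rw [this, hf'x₀]
      · exact hf'0 x hxA)
  have e1 : ∑ x ∈ A.erase x₀, f' x = ∑ x ∈ A, f' x := Finset.sum_erase _ hf'x₀
  have e2 : ∑ x ∈ A.erase x₀, ∑ y ∈ G.nbr x, max (f' x - f' y) 0 =
      ∑ x ∈ A, ∑ y ∈ G.nbr x, max (f' x - f' y) 0 := by
    refine Finset.sum_erase _ (Finset.sum_eq_zero fun y _ => ?_)
    rw [hf'x₀]
    exact max_eq_right (by linarith [hf'nn y])
  rw [e1, e2] at hih
  have e3 : ∑ x ∈ A, f x = ∑ x ∈ A, f' x + m * A.card := by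
    rw [Finset.sum_congr rfl hf'A, Finset.sum_sub_distrib]
    simp [mul_comm]
  have e4 : ∑ x ∈ A, ∑ y ∈ G.nbr x, max (f x - f y) 0 =
      ∑ x ∈ A, ∑ y ∈ G.nbr x, max (f' x - f' y) 0 + m * G.bdry A := by
    unfold bdry
    push_cast
    rw [Finset.mul_sum, ← Finset.sum_add_distrib]
    refine Finset.sum_congr rfl fun x hx => ?_
    rw [Finset.card_filter]
    push_cast
    rw [Finset.mul_sum, ← Finset.sum_add_distrib]
    refine Finset.sum_congr rfl fun y _ => ?_
    by_cases hy : y ∈ A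
    · rw [hf'A x hx, hf'A y hy]
      simp [hy]
    · rw [hf'0 y hy, hfA y hy, sub_zero, sub_zero, max_eq_left (hf x), max_eq_left (hf'nn x),
        hf'A x hx]
      simp [hy]
  rw [e3, e4, mul_add]
  have := mul_le_mul_of_nonneg_left (hK A hA) (hf x₀)
  nlinarith

/-- Faber–Krahn inequality for functions supported in `A`. -/
theorem faberKrahn {K : ℝ} (hK0 : 0 < K) {D : ℕ} (hD : 0 < D) (hval : G.BddVal D) {A : Finset X}
    (hK : ∀ B : Finset X, B ⊆ A → (B.card : ℝ) ≤ K * G.bdry B)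
    {v : X → ℝ} (hv : ∀ x, 0 ≤ v x) (hvA : ∀ x, x ∉ A → v x = 0) :
    ∑ x ∈ A, v x ^ 2 ≤ 4 * D * K ^ 2 * ∑ x ∈ A, ∑ y ∈ G.nbr x, (v x - v y) ^ 2 := by
  have hD' : (0 : ℝ) < D := by exact_mod_cast hD
  have h1 := coarea_le hK A subset_rfl (fun x => v x ^ 2) (fun x => by positivity)
    (fun x hx => by simp [hvA x hx])
  set s : ℝ := 2 * D * K with hs
  have hs0 : 0 < s := by positivity
  have hpt : ∀ x y, max (v x ^ 2 - v y ^ 2) 0 ≤ s * (v x - v y) ^ 2 + v x ^ 2 / s := by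
    intro x y
    refine max_le ?_ (by positivity)
    have hx := hv x
    have hy := hv y
    have h2 : s * (v x - v y) ^ 2 + v x ^ 2 / s - 2 * (v x - v y) * v x
        = (s * (v x - v y) - v x) ^ 2 / s := by
      field_simp
      ring
    have h3 : 0 ≤ (s * (v x - v y) - v x) ^ 2 / s := by positivity
    nlinarith [sq_nonneg (v x - v y)]
  have h2 : ∑ x ∈ A, ∑ y ∈ G.nbr x, max (v x ^ 2 - v y ^ 2) 0 ≤
      s * ∑ x ∈ A, ∑ y ∈ G.nbr x, (v x - v y) ^ 2 + D / s * ∑ x ∈ A, v x ^ 2 := by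
    rw [Finset.mul_sum, Finset.mul_sum, ← Finset.sum_add_distrib]
    refine Finset.sum_le_sum fun x _ => ?_
    calc ∑ y ∈ G.nbr x, max (v x ^ 2 - v y ^ 2) 0
        ≤ ∑ y ∈ G.nbr x, (s * (v x - v y) ^ 2 + v x ^ 2 / s) :=
          Finset.sum_le_sum fun y _ => hpt x y
      _ = s * ∑ y ∈ G.nbr x, (v x - v y) ^ 2 + (G.nbr x).card * (v x ^ 2 / s) := by
          rw [Finset.sum_add_distrib, Finset.mul_sum, Finset.sum_const, nsmul_eq_mul]
      _ ≤ s * ∑ y ∈ G.nbr x, (v x - v y) ^ 2 + D * (v x ^ 2 / s) := by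
          gcongr
          exact_mod_cast hval x
      _ = _ := by ring
  have h3 := mul_le_mul_of_nonneg_left h2 hK0.le
  have h4 : K * (s * ∑ x ∈ A, ∑ y ∈ G.nbr x, (v x - v y) ^ 2 + D / s * ∑ x ∈ A, v x ^ 2) =
      2 * D * K ^ 2 * ∑ x ∈ A, ∑ y ∈ G.nbr x, (v x - v y) ^ 2 + 1 / 2 * ∑ x ∈ A, v x ^ 2 := by
    rw [hs]
    field_simp
  linarith

theorem card_le_of_isoperimetric {d κ : ℝ} (hd : 0 < d)
    (hIS : ∀ A : Finset X, A.Nonempty → (A.card : ℝ) ^ (1 - 1 / d) ≤ κ * (G.bdry A : ℝ))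
    {N : ℝ} {A : Finset X} (hN : (A.card : ℝ) ≤ N) :
    (A.card : ℝ) ≤ κ * N ^ (1 / d) * G.bdry A := by
  rcases A.eq_empty_or_nonempty with rfl | hne
  · simp [bdry]
  have hc : (0 : ℝ) < A.card := by exact_mod_cast hne.card_pos
  have hN0 : 0 ≤ N := hc.le.trans hN
  calc (A.card : ℝ) = (A.card : ℝ) ^ (1 / d) * (A.card : ℝ) ^ (1 - 1 / d) := by
        rw [← Real.rpow_add hc]; simp
    _ ≤ N ^ (1 / d) * (κ * G.bdry A) := by
        gcongr
        exact hIS A hne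
    _ = _ := by ring

/-- Truncated form of Nash's inequality. -/
theorem nash_truncated {d κ : ℝ} (hd : 0 < d) (hκ : 0 < κ)
    (hIS : ∀ A : Finset X, A.Nonempty → (A.card : ℝ) ^ (1 - 1 / d) ≤ κ * (G.bdry A : ℝ))
    {D : ℕ} (hD : 0 < D) (hval : G.BddVal D) {u : X → ℝ} (hu : ∀ x, 0 ≤ u x) {S : Finset X}
    (hS : ∀ x, x ∉ S → u x = 0) {M : ℝ} (hM : ∑ x ∈ S, u x ≤ M) {t : ℝ} (ht : 0 < t)
    (hM0 : 0 < M) :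
    ∑ x ∈ S, u x ^ 2 ≤ 4 * D * κ ^ 2 * (M / t) ^ (2 / d) *
      ∑ x ∈ S, ∑ y ∈ G.nbr x, (u x - u y) ^ 2 + 2 * t * M := by
  classical
  set A := S.filter fun x => t < u x with hA
  set v : X → ℝ := fun x => max (u x - t) 0 with hv
  have hAmem : ∀ x, x ∉ A → v x = 0 := by
    intro x hx
    refine max_eq_right ?_
    by_cases hxS : x ∈ S
    · have : ¬ t < u x := fun h => hx (Finset.mem_filter.mpr ⟨hxS, h⟩)
      linarith
    · rw [hS x hxS]; linarith
  have hcard : (A.card : ℝ) ≤ M / t := by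
    rw [le_div_iff₀ ht]
    calc (A.card : ℝ) * t = ∑ x ∈ A, t := by simp
      _ ≤ ∑ x ∈ A, u x := Finset.sum_le_sum fun x hx => (Finset.mem_filter.mp hx).2.le
      _ ≤ ∑ x ∈ S, u x :=
          Finset.sum_le_sum_of_subset_of_nonneg (Finset.filter_subset _ _) fun x _ _ => hu x
      _ ≤ M := hM
  have hFK := faberKrahn (K := κ * (M / t) ^ (1 / d)) (by positivity) hD hval (A := A)
    (fun B hB => card_le_of_isoperimetric hd hIS
      (le_trans (by exact_mod_cast Finset.card_le_card hB) hcard))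
    (v := v) (fun x => le_max_right _ _) hAmem
  have hpow : (κ * (M / t) ^ (1 / d)) ^ 2 = κ ^ 2 * (M / t) ^ (2 / d) := by
    rw [mul_pow, ← Real.rpow_natCast ((M / t) ^ (1 / d)), ← Real.rpow_mul (by positivity)]
    congr 2
    push_cast
    ring
  rw [hpow] at hFK
  have hE : ∑ x ∈ A, ∑ y ∈ G.nbr x, (v x - v y) ^ 2 ≤
      ∑ x ∈ S, ∑ y ∈ G.nbr x, (u x - u y) ^ 2 := by
    refine (Finset.sum_le_sum fun x _ => Finset.sum_le_sum fun y _ => ?_).trans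
      (Finset.sum_le_sum_of_subset_of_nonneg (Finset.filter_subset _ _)
        fun x _ _ => Finset.sum_nonneg fun y _ => sq_nonneg _)
    refine sq_le_sq.mpr ((abs_max_sub_max_le_abs _ _ _).trans (le_of_eq ?_))
    congr 1
    ring
  have hsq : ∑ x ∈ S, u x ^ 2 ≤ ∑ x ∈ A, v x ^ 2 + 2 * t * ∑ x ∈ S, u x := by
    have : ∑ x ∈ A, v x ^ 2 = ∑ x ∈ S, v x ^ 2 :=
      Finset.sum_subset (Finset.filter_subset _ _) fun x _ hx => by simp [hAmem x hx]
    rw [this, Finset.mul_sum, ← Finset.sum_add_distrib]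
    refine Finset.sum_le_sum fun x _ => ?_
    have hux := hu x
    rcases le_total (u x) t with h | h
    · have : v x = 0 := max_eq_right (by linarith)
      rw [this]
      nlinarith
    · have : v x = u x - t := max_eq_left (by linarith)
      rw [this]
      nlinarith
  calc ∑ x ∈ S, u x ^ 2 ≤ ∑ x ∈ A, v x ^ 2 + 2 * t * ∑ x ∈ S, u x := hsq
    _ ≤ 4 * D * (κ ^ 2 * (M / t) ^ (2 / d)) * ∑ x ∈ A, ∑ y ∈ G.nbr x, (v x - v y) ^ 2
        + 2 * t * M := by gcongr
    _ ≤ 4 * D * (κ ^ 2 * (M / t) ^ (2 / d)) * ∑ x ∈ S, ∑ y ∈ G.nbr x, (u x - u y) ^ 2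
        + 2 * t * M := by gcongr
    _ = _ := by ring

/-- Nash's inequality for nonnegative functions of bounded mass. -/
theorem exists_nash {d : ℝ} (hd : 0 < d) (hIS : G.ISdim d) {D : ℕ} (hD : 0 < D)
    (hval : G.BddVal D) :
    ∃ c : ℝ, 0 < c ∧ ∀ (u : X → ℝ) (S : Finset X), (∀ x, 0 ≤ u x) → (∀ x, x ∉ S → u x = 0) →
      ∑ x ∈ S, u x ≤ D →
      c * (∑ x ∈ S, (G.nbr x).card * u x ^ 2) ^ (1 + 2 / d) ≤
        ∑ x ∈ S, ∑ y ∈ G.nbr x, (u x - u y) ^ 2 := by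
  obtain ⟨κ, hκ, hIS⟩ := hIS
  have hD' : (0 : ℝ) < D := by exact_mod_cast hD
  refine ⟨(8 * D ^ 2 * κ ^ 2 * (4 * D ^ 3) ^ (2 / d))⁻¹, by positivity, ?_⟩
  intro u S hu hS hM
  set a := ∑ x ∈ S, (G.nbr x).card * u x ^ 2 with ha
  set E := ∑ x ∈ S, ∑ y ∈ G.nbr x, (u x - u y) ^ 2 with hE
  have hE0 : 0 ≤ E := Finset.sum_nonneg fun x _ => Finset.sum_nonneg fun y _ => sq_nonneg _
  have ha0 : 0 ≤ a := Finset.sum_nonneg fun x _ => by positivity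
  rcases ha0.eq_or_lt with h | h
  · have h2 : 1 + 2 / d ≠ 0 := by positivity
    rw [← h, Real.zero_rpow h2, mul_zero]
    exact hE0
  have haD : a ≤ D * ∑ x ∈ S, u x ^ 2 := by
    rw [Finset.mul_sum]
    refine Finset.sum_le_sum fun x _ => ?_
    gcongr
    exact_mod_cast hval x
  have ht : 0 < a / (4 * (D : ℝ) ^ 2) := div_pos h (mul_pos four_pos (pow_pos hD' 2))
  have hN := nash_truncated hd hκ hIS hD hval hu hS hM ht hD'
  have e1 : (D : ℝ) / (a / (4 * D ^ 2)) = 4 * D ^ 3 / a := by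
    rw [div_div_eq_mul_div]
    ring
  rw [e1, Real.div_rpow (by positivity) h.le] at hN
  clear_value a E
  have hpos : 0 < a ^ (2 / d) := by positivity
  set w := (4 * (D : ℝ) ^ 3) ^ (2 / d) with hw
  have hw0 : 0 < w := by positivity
  have e2 : 2 * (a / (4 * (D : ℝ) ^ 2)) * D = a / (2 * D) := by
    field_simp
    norm_num
  rw [e2, ← hE] at hN
  have h3 : a / (2 * D) ≤ 4 * D * κ ^ 2 * (w / a ^ (2 / d)) * E := by
    have : a / D ≤ ∑ x ∈ S, u x ^ 2 := by
      rw [div_le_iff₀ hD']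
      linarith
    have h4 : a / D = a / (2 * D) + a / (2 * D) := by
      field_simp
      norm_num
    linarith
  rw [Real.rpow_add h, Real.rpow_one, inv_mul_le_iff₀ (by positivity)]
  rw [div_le_iff₀ (by positivity)] at h3
  calc a * a ^ (2 / d) ≤ (4 * D * κ ^ 2 * (w / a ^ (2 / d)) * E * (2 * D)) * a ^ (2 / d) := by
        gcongr
    _ = 8 * D ^ 2 * κ ^ 2 * w * E * (a ^ (2 / d) / a ^ (2 / d)) := by ring
    _ = 8 * D ^ 2 * κ ^ 2 * w * E := by rw [div_self hpos.ne', mul_one]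

theorem ISdim.nbr_nonempty {d : ℝ} (hIS : G.ISdim d) (x : X) : (G.nbr x).Nonempty := by
  obtain ⟨κ, -, h⟩ := hIS
  by_contra hx
  have := h {x} (Finset.singleton_nonempty x)
  rw [Finset.not_nonempty_iff_eq_empty] at hx
  simp [bdry, hx] at this
  linarith

end LFGraph

namespace LFGraph

variable {X : Type*} {G : LFGraph X}

/-- Oriented edges, fibred over their origin. -/
def sigmaEquivEdge (G : LFGraph X) : (Σ x : X, {y // y ∈ G.nbr x}) ≃ G.Edge where
  toFun s := ⟨(s.1, s.2.1), s.2.2⟩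
  invFun e := ⟨e.1.1, ⟨e.1.2, e.2⟩⟩
  left_inv _ := rfl
  right_inv _ := rfl

/-- Reversal of oriented edges. -/
def edgeSwap (G : LFGraph X) : G.Edge ≃ G.Edge where
  toFun e := ⟨(e.1.2, e.1.1), (G.symm _ _).mp e.2⟩
  invFun e := ⟨(e.1.2, e.1.1), (G.symm _ _).mp e.2⟩
  left_inv _ := rfl
  right_inv _ := rfl

theorem hasSum_edge {ψ : X → X → ℝ} (h : Summable fun e : G.Edge => ψ e.1.1 e.1.2) :
    HasSum (fun x => ∑ y ∈ G.nbr x, ψ x y) (∑' e : G.Edge, ψ e.1.1 e.1.2) := by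
  have h1 := (G.sigmaEquivEdge.hasSum_iff).mpr h.hasSum
  refine h1.sigma fun x => ?_
  have h2 := hasSum_fintype fun y : {y // y ∈ G.nbr x} => ψ x y
  rwa [Finset.sum_coe_sort (G.nbr x) (fun y => ψ x y)] at h2

theorem summable_edge_of_nonneg {ψ : X → X → ℝ} (h0 : ∀ x y, 0 ≤ ψ x y)
    (h : Summable fun x => ∑ y ∈ G.nbr x, ψ x y) :
    Summable fun e : G.Edge => ψ e.1.1 e.1.2 := by
  rw [← G.sigmaEquivEdge.summable_iff]
  refine (summable_sigma_of_nonneg fun s => h0 _ _).mpr ⟨fun x => Summable.of_finite, h.congr fun x => ?_⟩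
  rw [tsum_fintype]
  exact (Finset.sum_coe_sort (G.nbr x) (fun y => ψ x y)).symm

theorem summable_edge_swap {ψ : X → X → ℝ} (h : Summable fun e : G.Edge => ψ e.1.1 e.1.2) :
    Summable fun e : G.Edge => ψ e.1.2 e.1.1 :=
  G.edgeSwap.summable_iff.mpr h

theorem tsum_edge_swap (ψ : X → X → ℝ) :
    ∑' e : G.Edge, ψ e.1.2 e.1.1 = ∑' e : G.Edge, ψ e.1.1 e.1.2 :=
  G.edgeSwap.tsum_eq fun e => ψ e.1.1 e.1.2

theorem summable_edge_fst {D : ℕ} (hval : G.BddVal D) {F : X → ℝ} (hF : Summable F) :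
    Summable fun e : G.Edge => F e.1.1 := by
  refine Summable.of_abs ?_
  refine summable_edge_of_nonneg (ψ := fun x _ => |F x|) (fun _ _ => abs_nonneg _) ?_
  refine Summable.of_nonneg_of_le (fun x => Finset.sum_nonneg fun _ _ => abs_nonneg _)
    (fun x => ?_) (hF.abs.mul_left (D : ℝ))
  rw [Finset.sum_const, nsmul_eq_mul]
  gcongr
  exact_mod_cast hval x

theorem summable_edge_snd {D : ℕ} (hval : G.BddVal D) {F : X → ℝ} (hF : Summable F) :
    Summable fun e : G.Edge => F e.1.2 :=
  summable_edge_swap (ψ := fun x _ => F x) (summable_edge_fst hval hF)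

theorem hasSum_card_mul {D : ℕ} (hval : G.BddVal D) {F : X → ℝ} (hF : Summable F) :
    HasSum (fun x => (G.nbr x).card * F x) (∑' e : G.Edge, F e.1.1) := by
  simpa using hasSum_edge (ψ := fun x _ => F x) (summable_edge_fst hval hF)

theorem hasSum_sum_nbr {D : ℕ} (hval : G.BddVal D) {F : X → ℝ} (hF : Summable F) :
    HasSum (fun x => ∑ y ∈ G.nbr x, F y) (∑' e : G.Edge, F e.1.1) := by
  have h := hasSum_edge (ψ := fun _ y => F y) (summable_edge_snd hval hF)
  rwa [tsum_edge_swap fun x _ => F x] at h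

/-- The Markov operator of the simple random walk, as a linear map. -/
noncomputable def markov (G : LFGraph X) : Module.End ℝ (X → ℝ) where
  toFun := G.pAvg
  map_add' f g := by
    ext x
    simp [pAvg, Finset.sum_add_distrib, add_div]
  map_smul' c f := by
    ext x
    simp [pAvg, ← Finset.mul_sum, mul_div_assoc]

/-- The Markov operator of the lazy random walk. -/
noncomputable def lazyOp (G : LFGraph X) : Module.End ℝ (X → ℝ) := (1 / 2 : ℝ) • (G.markov + 1)

theorem markov_apply (f : X → ℝ) (x : X) :
    G.markov f x = (∑ y ∈ G.nbr x, f y) / (G.nbr x).card := rfl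

theorem lazyOp_apply (f : X → ℝ) (x : X) :
    G.lazyOp f x = (G.markov f x + f x) / 2 := by
  simp [lazyOp]
  ring

theorem lazyOp_pow_succ_apply (n : ℕ) (f : X → ℝ) :
    (G.lazyOp ^ (n + 1)) f = G.lazyOp ((G.lazyOp ^ n) f) := by
  rw [pow_succ', Module.End.mul_apply]

theorem walk_support_finite (n : ℕ) (x : X) : (Function.support (G.walk n x)).Finite := by
  induction n generalizing x with
  | zero =>
    refine (Set.finite_singleton x).subset fun y hy => ?_
    by_contra h
    exact hy (if_neg h)
  | succ n ih =>
    refine ((G.nbr x).finite_toSet.biUnion fun z _ => ih z).subset fun y hy => ?_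
    by_contra h
    simp only [Set.mem_iUnion, not_exists, Function.mem_support, not_not] at h
    apply hy
    simp only [walk]
    rw [Finset.sum_eq_zero fun z hz => h z hz, zero_div]

theorem avg_eq_markov_pow (n : ℕ) (g : X → ℝ) (x : X) : G.avg n g x = (G.markov ^ n) g x := by
  induction n generalizing x with
  | zero =>
    rw [avg, tsum_eq_single x fun y hy => by simp [walk, hy]]
    simp [walk]
  | succ n ih =>
    have hs : ∀ z, Summable fun y => G.walk n z y * g y := fun z =>
      summable_of_hasFiniteSupport ((walk_support_finite n z).subset
        (Function.support_mul_subset_left _ _))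
    rw [pow_succ', Module.End.mul_apply, markov_apply, avg]
    simp_rw [← ih, avg]
    rw [← Summable.tsum_finsetSum fun z _ => hs z, ← tsum_div_const]
    refine tsum_congr fun y => ?_
    rw [walk, ← Finset.sum_mul]
    ring

theorem tendsto_lazyOp_pow {g : X → ℝ} {x : X} {l : ℝ}
    (h : Tendsto (fun n => G.avg n g x) atTop (𝓝 l)) :
    Tendsto (fun n => (G.lazyOp ^ n) g x) atTop (𝓝 l) := by
  refine (tendsto_binomial_mean h).congr fun n => ?_
  rw [lazyOp, smul_pow, (Commute.one_right G.markov).add_pow]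
  simp only [one_pow, mul_one, LinearMap.smul_apply, LinearMap.sum_apply, Pi.smul_apply,
    Finset.sum_apply, smul_eq_mul, Finset.mul_sum, avg_eq_markov_pow]
  refine Finset.sum_congr rfl fun k _ => ?_
  rw [← nsmul_eq_mul']
  simp
  ring

theorem lazyOp_mono {f g : X → ℝ} (h : f ≤ g) : G.lazyOp f ≤ G.lazyOp g := by
  intro x
  rw [lazyOp_apply, lazyOp_apply, markov_apply, markov_apply]
  have h1 := Finset.sum_le_sum fun y (_ : y ∈ G.nbr x) => h y
  have h2 := h x
  gcongr

theorem lazyOp_pow_mono (n : ℕ) {f g : X → ℝ} (h : f ≤ g) :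
    (G.lazyOp ^ n) f ≤ (G.lazyOp ^ n) g := by
  induction n with
  | zero => simpa using h
  | succ n ih =>
    rw [lazyOp_pow_succ_apply, lazyOp_pow_succ_apply]
    exact lazyOp_mono ih

theorem lazyOp_pow_nonneg (n : ℕ) {f : X → ℝ} (h : 0 ≤ f) : 0 ≤ (G.lazyOp ^ n) f := by
  simpa using lazyOp_pow_mono (G := G) n h

theorem abs_markov_rpow_le (hdeg : ∀ x, (G.nbr x).Nonempty) {p : ℝ} (hp : 1 ≤ p) (f : X → ℝ)
    (x : X) : |G.markov f x| ^ p ≤ G.markov (fun y => |f y| ^ p) x := by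
  have hc : (0 : ℝ) < (G.nbr x).card := by exact_mod_cast (hdeg x).card_pos
  have h := Real.rpow_arith_mean_le_arith_mean_rpow (G.nbr x)
    (fun _ => (1 : ℝ) / (G.nbr x).card) (fun y => |f y|) (fun _ _ => by positivity)
    (by rw [Finset.sum_const, nsmul_eq_mul]; field_simp) (fun _ _ => abs_nonneg _) hp
  simp_rw [one_div_mul_eq_div, ← Finset.sum_div] at h
  rw [markov_apply, markov_apply, abs_div, abs_of_pos hc]
  refine le_trans ?_ h
  gcongr
  exact Finset.abs_sum_le_sum_abs _ _

theorem abs_lazyOp_rpow_le (hdeg : ∀ x, (G.nbr x).Nonempty) {p : ℝ} (hp : 1 ≤ p) (f : X → ℝ)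
    (x : X) : |G.lazyOp f x| ^ p ≤ G.lazyOp (fun y => |f y| ^ p) x := by
  have h := abs_add_rpow_le hp (G.markov f x) (f x)
  have h1 := abs_markov_rpow_le hdeg hp f x
  have h2 : (0 : ℝ) < 2 ^ p := by positivity
  rw [lazyOp_apply, lazyOp_apply, abs_div, abs_two, Real.div_rpow (abs_nonneg _) zero_le_two,
    div_le_iff₀ h2]
  nlinarith

theorem abs_lazyOp_pow_rpow_le (hdeg : ∀ x, (G.nbr x).Nonempty) {p : ℝ} (hp : 1 ≤ p) (n : ℕ)
    (f : X → ℝ) (x : X) :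
    |(G.lazyOp ^ n) f x| ^ p ≤ (G.lazyOp ^ n) (fun y => |f y| ^ p) x := by
  induction n generalizing x with
  | zero => simp
  | succ n ih =>
    rw [lazyOp_pow_succ_apply, lazyOp_pow_succ_apply]
    exact (abs_lazyOp_rpow_le hdeg hp _ x).trans (lazyOp_mono (fun y => ih y) x)

theorem card_mul_lazyOp (hdeg : ∀ x, (G.nbr x).Nonempty) (f : X → ℝ) (x : X) :
    (G.nbr x).card * G.lazyOp f x = (∑ y ∈ G.nbr x, f y + (G.nbr x).card * f x) / 2 := by
  have hc : (0 : ℝ) < (G.nbr x).card := by exact_mod_cast (hdeg x).card_pos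
  rw [lazyOp_apply, markov_apply]
  field_simp

theorem hasSum_card_mul_lazyOp (hdeg : ∀ x, (G.nbr x).Nonempty) {D : ℕ} (hval : G.BddVal D)
    {F : X → ℝ} (hF : Summable F) :
    HasSum (fun x => (G.nbr x).card * G.lazyOp F x) (∑' x, (G.nbr x).card * F x) := by
  have h := ((hasSum_sum_nbr hval hF).add (hasSum_card_mul hval hF)).div_const 2
  rw [add_self_div_two] at h
  simp_rw [card_mul_lazyOp hdeg]
  rw [(hasSum_card_mul hval hF).tsum_eq]
  exact h

theorem abs_le_card_mul_abs (hdeg : ∀ x, (G.nbr x).Nonempty) (f : X → ℝ) (x : X) :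
    |f x| ≤ |(G.nbr x).card * f x| := by
  have hc : (1 : ℝ) ≤ (G.nbr x).card := by exact_mod_cast (hdeg x).card_pos
  rw [abs_mul, Nat.abs_cast]
  nlinarith [abs_nonneg (f x)]

theorem summable_lazyOp_pow (hdeg : ∀ x, (G.nbr x).Nonempty) {D : ℕ} (hval : G.BddVal D)
    {F : X → ℝ} (hF : Summable F) (n : ℕ) : Summable ((G.lazyOp ^ n) F) := by
  induction n with
  | zero => simpa using hF
  | succ n ih =>
    rw [lazyOp_pow_succ_apply]
    exact Summable.of_norm_bounded (hasSum_card_mul_lazyOp hdeg hval ih).summable.abs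
      (abs_le_card_mul_abs hdeg _)

theorem tsum_card_mul_lazyOp_pow (hdeg : ∀ x, (G.nbr x).Nonempty) {D : ℕ} (hval : G.BddVal D)
    {F : X → ℝ} (hF : Summable F) (n : ℕ) :
    ∑' x, (G.nbr x).card * (G.lazyOp ^ n) F x = ∑' x, (G.nbr x).card * F x := by
  induction n with
  | zero => simp
  | succ n ih =>
    rw [lazyOp_pow_succ_apply, ← ih]
    exact (hasSum_card_mul_lazyOp hdeg hval (summable_lazyOp_pow hdeg hval hF n)).tsum_eq

theorem sum_lazyOp_pow_le (hdeg : ∀ x, (G.nbr x).Nonempty) {D : ℕ} (hval : G.BddVal D)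
    {F : X → ℝ} (hF0 : 0 ≤ F) (hF : Summable F) (n : ℕ) (S : Finset X) :
    ∑ x ∈ S, (G.lazyOp ^ n) F x ≤ D * ∑' x, F x := by
  have hnn := lazyOp_pow_nonneg (G := G) n hF0
  have hs := (hasSum_card_mul hval (summable_lazyOp_pow hdeg hval hF n)).summable
  calc ∑ x ∈ S, (G.lazyOp ^ n) F x ≤ ∑ x ∈ S, (G.nbr x).card * (G.lazyOp ^ n) F x := by
        refine Finset.sum_le_sum fun x _ => ?_
        have hc : (1 : ℝ) ≤ (G.nbr x).card := by exact_mod_cast (hdeg x).card_pos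
        nlinarith [hnn x, show (0 : X → ℝ) x = 0 from rfl]
    _ ≤ ∑' x, (G.nbr x).card * (G.lazyOp ^ n) F x :=
        hs.sum_le_tsum _ fun x _ => mul_nonneg (Nat.cast_nonneg _) (hnn x)
    _ = ∑' x, (G.nbr x).card * F x := tsum_card_mul_lazyOp_pow hdeg hval hF n
    _ ≤ ∑' x, D * F x := by
        refine Summable.tsum_le_tsum (fun x => ?_) (hasSum_card_mul hval hF).summable
          (hF.mul_left _)
        exact mul_le_mul_of_nonneg_right (by exact_mod_cast hval x) (hF0 x)
    _ = D * ∑' x, F x := tsum_mul_left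

theorem lpMem_lazyOp (hdeg : ∀ x, (G.nbr x).Nonempty) {D : ℕ} (hval : G.BddVal D) {p : ℝ}
    (hp : 1 ≤ p) {f : X → ℝ} (hf : lpMem p f) : lpMem p (G.lazyOp f) := by
  have h := summable_lazyOp_pow hdeg hval hf 1
  rw [pow_one] at h
  exact Summable.of_nonneg_of_le (fun x => by positivity) (abs_lazyOp_rpow_le hdeg hp f) h

theorem summable_sq_lazyOp_pow (hdeg : ∀ x, (G.nbr x).Nonempty) {D : ℕ} (hval : G.BddVal D)
    {u : X → ℝ} (hu : Summable fun x => u x ^ 2) (n : ℕ) :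
    Summable fun x => (G.lazyOp ^ n) u x ^ 2 := by
  have h := summable_lazyOp_pow hdeg hval hu n
  refine Summable.of_nonneg_of_le (fun x => sq_nonneg _) (fun x => ?_) h
  simpa [Real.rpow_two] using abs_lazyOp_pow_rpow_le hdeg one_le_two n u x

theorem summable_mul_of_sq {ι : Type*} {u v : ι → ℝ} (hu : Summable fun x => u x ^ 2)
    (hv : Summable fun x => v x ^ 2) : Summable fun x => u x * v x := by
  refine Summable.of_norm_bounded (hu.add hv) fun x => ?_
  rw [Real.norm_eq_abs, abs_le]
  constructor <;> nlinarith [sq_nonneg (u x + v x), sq_nonneg (u x - v x), sq_nonneg (u x),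
    sq_nonneg (v x)]

/-- The lazy Markov operator is self-adjoint with respect to the valency measure. -/
theorem tsum_lazyOp_mul (hdeg : ∀ x, (G.nbr x).Nonempty) {D : ℕ} (hval : G.BddVal D)
    {u v : X → ℝ} (hu : Summable fun x => u x ^ 2) (hv : Summable fun x => v x ^ 2) :
    ∑' x, (G.nbr x).card * (G.lazyOp u x * v x) = ∑' x, (G.nbr x).card * (u x * G.lazyOp v x) := by
  have huv := hasSum_card_mul hval (summable_mul_of_sq hu hv)
  have hu1 := summable_edge_fst hval hu
  have hu2 := summable_edge_snd hval hu
  have hv1 := summable_edge_fst hval hv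
  have hv2 := summable_edge_snd hval hv
  have h1 := hasSum_edge (ψ := fun x y => u y * v x) (summable_mul_of_sq hu2 hv1)
  have h2 := hasSum_edge (ψ := fun x y => u x * v y) (summable_mul_of_sq hu1 hv2)
  have h12 : ∑' x, ∑ y ∈ G.nbr x, u y * v x = ∑' x, ∑ y ∈ G.nbr x, u x * v y := by
    rw [h1.tsum_eq, h2.tsum_eq]
    exact tsum_edge_swap fun x y => u x * v y
  calc ∑' x, (G.nbr x).card * (G.lazyOp u x * v x)
      = ∑' x, (∑ y ∈ G.nbr x, u y * v x + (G.nbr x).card * (u x * v x)) / 2 :=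
        tsum_congr fun x => by
          rw [← mul_assoc, card_mul_lazyOp hdeg, ← Finset.sum_mul]
          ring
    _ = ∑' x, (∑ y ∈ G.nbr x, u x * v y + (G.nbr x).card * (u x * v x)) / 2 :=
        by
          rw [tsum_div_const, tsum_div_const, h1.summable.tsum_add huv.summable,
            h2.summable.tsum_add huv.summable, h12]
    _ = ∑' x, (G.nbr x).card * (u x * G.lazyOp v x) :=
        tsum_congr fun x => by
          rw [mul_left_comm _ (u x) (G.lazyOp v x), card_mul_lazyOp hdeg, ← Finset.mul_sum]
          ring

theorem tsum_lazyOp_pow_mul (hdeg : ∀ x, (G.nbr x).Nonempty) {D : ℕ} (hval : G.BddVal D)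
    {u v : X → ℝ} (hu : Summable fun x => u x ^ 2) (hv : Summable fun x => v x ^ 2) (n : ℕ) :
    ∑' x, (G.nbr x).card * ((G.lazyOp ^ n) u x * v x) =
      ∑' x, (G.nbr x).card * (u x * (G.lazyOp ^ n) v x) := by
  induction n generalizing v with
  | zero => simp
  | succ n ih =>
    have hv1 := summable_sq_lazyOp_pow hdeg hval hv 1
    rw [pow_one] at hv1
    rw [lazyOp_pow_succ_apply, tsum_lazyOp_mul hdeg hval (summable_sq_lazyOp_pow hdeg hval hu n) hv,
      ih hv1, pow_succ, Module.End.mul_apply]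

theorem summable_edge_sq_sub {D : ℕ} (hval : G.BddVal D) {u : X → ℝ}
    (hu : Summable fun x => u x ^ 2) : Summable fun e : G.Edge => (u e.1.1 - u e.1.2) ^ 2 := by
  refine Summable.of_nonneg_of_le (fun e => sq_nonneg _) (fun e => ?_)
    (((summable_edge_fst hval hu).add (summable_edge_snd hval hu)).mul_left 2)
  nlinarith [sq_nonneg (u e.1.1 + u e.1.2)]

/-- The energy dissipated by one step of the lazy walk. -/
theorem tsum_sq_lazyOp_le (hdeg : ∀ x, (G.nbr x).Nonempty) {D : ℕ} (hval : G.BddVal D)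
    {u : X → ℝ} (hu : Summable fun x => u x ^ 2) :
    ∑' x, (G.nbr x).card * G.lazyOp u x ^ 2 ≤
      ∑' x, (G.nbr x).card * u x ^ 2 - 1 / 4 * ∑' e : G.Edge, (u e.1.1 - u e.1.2) ^ 2 := by
  have h1 := hasSum_card_mul hval hu
  have h2 := hasSum_sum_nbr hval hu
  have h3 := hasSum_edge (ψ := fun x y => (u x - u y) ^ 2) (summable_edge_sq_sub hval hu)
  have h4 := ((h1.add h2).div_const 2).sub (h3.mul_left (1 / 4))
  have hL := summable_sq_lazyOp_pow hdeg hval hu 1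
  rw [pow_one] at hL
  rw [h1.tsum_eq]
  refine (Summable.tsum_le_tsum (fun x => ?_) (hasSum_card_mul hval hL).summable
    h4.summable).trans (le_of_eq (h4.tsum_eq.trans (by ring)))
  have hc : (0 : ℝ) < (G.nbr x).card := by exact_mod_cast (hdeg x).card_pos
  have hz : (G.nbr x).card * G.lazyOp u x = ∑ y ∈ G.nbr x, (u x + u y) / 2 := by
    rw [card_mul_lazyOp hdeg, ← Finset.sum_div, Finset.sum_add_distrib, Finset.sum_const,
      nsmul_eq_mul, add_comm]
  have hcs := sq_sum_le_card_mul_sum_sq (s := G.nbr x) (f := fun y => (u x + u y) / 2)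
  rw [← hz, mul_pow, sq ((G.nbr x).card : ℝ), mul_assoc] at hcs
  refine (le_of_mul_le_mul_left hcs hc).trans (le_of_eq ?_)
  calc ∑ y ∈ G.nbr x, ((u x + u y) / 2) ^ 2
      = ∑ y ∈ G.nbr x, ((u x ^ 2 + u y ^ 2) / 2 - 1 / 4 * (u x - u y) ^ 2) :=
        Finset.sum_congr rfl fun y _ => by ring
    _ = _ := by
        rw [Finset.sum_sub_distrib, ← Finset.sum_div, Finset.sum_add_distrib, Finset.sum_const,
          nsmul_eq_mul, Finset.mul_sum]

end LFGraph

namespace LFGraph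

variable {X : Type*} {G : LFGraph X}

/-- The unit mass at a vertex. -/
noncomputable def delta (z : X) : X → ℝ := Set.indicator {z} 1

theorem delta_self (z : X) : delta z z = 1 := by simp [delta]

theorem delta_ne {z x : X} (h : x ≠ z) : delta z x = 0 := by simp [delta, h]

theorem delta_nonneg (z : X) : 0 ≤ delta z := Set.indicator_nonneg fun _ _ => zero_le_one

theorem hasSum_mul_delta (f : X → ℝ) (z : X) : HasSum (fun x => f x * delta z x) (f z) := by
  simpa [delta_self] using hasSum_single (f := fun x => f x * delta z x) z
    fun x hx => by simp [delta_ne hx]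

theorem summable_delta (z : X) : Summable (delta z) := by
  simpa using (hasSum_mul_delta (fun _ => 1) z).summable

theorem summable_sq_delta (z : X) : Summable fun x => delta z x ^ 2 := by
  simpa [sq] using (hasSum_mul_delta (delta z) z).summable

theorem lazyOp_pow_support_finite {u : X → ℝ} (hu : (Function.support u).Finite) (n : ℕ) :
    (Function.support ((G.lazyOp ^ n) u)).Finite := by
  induction n with
  | zero => simpa using hu
  | succ n ih =>
    rw [lazyOp_pow_succ_apply]
    refine (ih.union (ih.biUnion fun y _ => (G.nbr y).finite_toSet)).subset fun x hx => ?_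
    by_contra h
    simp only [Set.mem_union, Set.mem_iUnion, not_or, not_exists, Function.mem_support,
      not_not, Finset.mem_coe] at h
    refine hx ?_
    rw [lazyOp_apply, markov_apply, h.1, Finset.sum_eq_zero]
    · simp
    · intro y hy
      by_contra hne
      exact h.2 y hne ((G.symm x y).mp hy)

theorem exists_tsum_sq_lazyOp_pow_delta_le {d : ℝ} (hd : 0 < d) (hIS : G.ISdim d) {D : ℕ}
    (hD : 0 < D) (hval : G.BddVal D) :
    ∃ C : ℝ, 0 < C ∧ ∀ (z : X) (n : ℕ),
      ∑' x, (G.nbr x).card * (G.lazyOp ^ n) (delta z) x ^ 2 ≤ C * ((n : ℝ) + 1) ^ (-(d / 2)) := by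
  have hdeg := hIS.nbr_nonempty
  have hD' : (0 : ℝ) < D := by exact_mod_cast hD
  obtain ⟨c, hc, hnash⟩ := exists_nash hd hIS hD hval
  obtain ⟨C, hC, hdecay⟩ := exists_decay_of_sub_rpow hD' (by positivity : 0 < 1 / 4 * c)
    (by positivity : 0 < 2 / d)
  refine ⟨C, hC, fun z n => ?_⟩
  have hmain := hdecay (fun n => ∑' x, (G.nbr x).card * (G.lazyOp ^ n) (delta z) x ^ 2)
    (fun n => tsum_nonneg fun x => by positivity) ?_ ?_ n
  · simpa [one_div_div] using hmain
  · have h : ∀ x, ((G.nbr x).card : ℝ) * (G.lazyOp ^ 0) (delta z) x ^ 2 =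
        (G.nbr x).card * delta z x * delta z x := fun x => by simp [sq, mul_assoc]
    simp_rw [h, (hasSum_mul_delta (fun x => (G.nbr x).card * delta z x) z).tsum_eq, delta_self,
      mul_one]
    exact_mod_cast hval z
  · intro n
    set u := (G.lazyOp ^ n) (delta z) with hu
    have hu0 : 0 ≤ u := lazyOp_pow_nonneg n (delta_nonneg z)
    have hu2 : Summable fun x => u x ^ 2 :=
      summable_sq_lazyOp_pow hdeg hval (summable_sq_delta z) n
    have hfin : (Function.support u).Finite := by
      refine lazyOp_pow_support_finite ((Set.finite_singleton z).subset fun x hx => ?_) n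
      by_contra h
      exact hx (delta_ne h)
    have hS : ∀ x, x ∉ hfin.toFinset → u x = 0 := fun x hx => by
      simpa using hx
    have hmass : ∑ x ∈ hfin.toFinset, u x ≤ D := by
      have h := sum_lazyOp_pow_le hdeg hval (delta_nonneg z) (summable_delta z) n hfin.toFinset
      have h1 := (hasSum_mul_delta (fun _ => 1) z).tsum_eq
      simp only [one_mul] at h1
      rwa [h1, mul_one] at h
    have h1 := hnash u hfin.toFinset hu0 hS hmass
    have h2 := sum_le_hasSum hfin.toFinset (fun x _ => Finset.sum_nonneg fun y _ => sq_nonneg _)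
      (hasSum_edge (ψ := fun x y => (u x - u y) ^ 2) (summable_edge_sq_sub hval hu2))
    have h3 : ∑' x, (G.nbr x).card * u x ^ 2 = ∑ x ∈ hfin.toFinset, (G.nbr x).card * u x ^ 2 :=
      tsum_eq_sum fun x hx => by simp [hS x hx]
    have h4 := tsum_sq_lazyOp_le hdeg hval hu2
    rw [lazyOp_pow_succ_apply, ← hu]
    rw [← h3] at h1
    linarith

/-- The heat kernel bound `O(n^{-d/2})` along even times. -/
theorem exists_lazyOp_pow_delta_le {d : ℝ} (hd : 0 < d) (hIS : G.ISdim d) {D : ℕ}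
    (hD : 0 < D) (hval : G.BddVal D) :
    ∃ C : ℝ, 0 < C ∧ ∀ (z x : X) (n : ℕ),
      (G.lazyOp ^ (n + n)) (delta z) x ≤ C * ((n : ℝ) + 1) ^ (-(d / 2)) := by
  have hdeg := hIS.nbr_nonempty
  obtain ⟨C, hC, hbound⟩ := exists_tsum_sq_lazyOp_pow_delta_le hd hIS hD hval
  refine ⟨C, hC, fun z x n => ?_⟩
  set u := (G.lazyOp ^ n) (delta z) with hu
  set v := (G.lazyOp ^ n) (delta x) with hv
  have hu2 : Summable fun x => u x ^ 2 :=
    summable_sq_lazyOp_pow hdeg hval (summable_sq_delta z) n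
  have hv2 : Summable fun y => v y ^ 2 :=
    summable_sq_lazyOp_pow hdeg hval (summable_sq_delta x) n
  have h1 := tsum_lazyOp_pow_mul hdeg hval hu2 (summable_sq_delta x) n
  have hcomp : (G.lazyOp ^ n) u = (G.lazyOp ^ (n + n)) (delta z) := by
    rw [pow_add, Module.End.mul_apply]
  rw [hcomp, ← hv] at h1
  simp_rw [← mul_assoc] at h1
  rw [(hasSum_mul_delta _ x).tsum_eq] at h1
  have h2 : ∑' y, (G.nbr y).card * u y * v y ≤
      (∑' y, (G.nbr y).card * u y ^ 2 + ∑' y, (G.nbr y).card * v y ^ 2) / 2 := by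
    have hsu := (hasSum_card_mul hval hu2).summable
    have hsv := (hasSum_card_mul hval hv2).summable
    rw [← hsu.tsum_add hsv, ← tsum_div_const]
    have huv := (hasSum_card_mul hval (summable_mul_of_sq hu2 hv2)).summable
    simp_rw [← mul_assoc] at huv
    refine huv.tsum_le_tsum (fun y => ?_) ((hsu.add hsv).div_const 2)
    have hc : (0 : ℝ) ≤ (G.nbr y).card := by positivity
    nlinarith [mul_nonneg hc (sq_nonneg (u y - v y))]
  have h3 := hbound z n
  have h4 := hbound x n
  have hnn : 0 ≤ (G.lazyOp ^ (n + n)) (delta z) x := lazyOp_pow_nonneg _ (delta_nonneg z) x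
  have hc : (1 : ℝ) ≤ (G.nbr x).card := by exact_mod_cast (hdeg x).card_pos
  nlinarith

/-- `lazyOp ^ n` at a vertex depends on finitely many values only. -/
theorem exists_finset_lazyOp_pow_congr (G : LFGraph X) (n : ℕ) (x : X) :
    ∃ S : Finset X, ∀ f g : X → ℝ, (∀ y ∈ S, f y = g y) →
      (G.lazyOp ^ n) f x = (G.lazyOp ^ n) g x := by
  classical
  induction n generalizing x with
  | zero => exact ⟨{x}, fun f g h => by simpa using h x⟩
  | succ n ih =>
    choose S hS using ih
    refine ⟨S x ∪ (G.nbr x).biUnion S, fun f g h => ?_⟩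
    rw [lazyOp_pow_succ_apply, lazyOp_pow_succ_apply, lazyOp_apply, lazyOp_apply, markov_apply,
      markov_apply, hS x f g fun y hy => h y (Finset.mem_union_left _ hy),
      Finset.sum_congr rfl fun z hz => hS z f g fun y hy =>
        h y (Finset.mem_union_right _ (Finset.mem_biUnion.mpr ⟨z, hz, hy⟩))]

theorem lazyOp_pow_le_of_delta_le {n : ℕ} {x : X} {b : ℝ}
    (hb : ∀ z, (G.lazyOp ^ n) (delta z) x ≤ b) (hb0 : 0 ≤ b) {F : X → ℝ} (hF0 : 0 ≤ F)
    (hF : Summable F) : (G.lazyOp ^ n) F x ≤ b * ∑' y, F y := by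
  classical
  obtain ⟨S, hS⟩ := exists_finset_lazyOp_pow_congr G n x
  have h1 : ∀ y ∈ S, F y = (∑ z ∈ S, F z • delta z) y := by
    intro y hy
    rw [Finset.sum_apply, Finset.sum_eq_single y]
    · simp [delta_self]
    · intro z _ hzy
      simp [delta_ne hzy.symm]
    · exact fun h => absurd hy h
  rw [hS _ _ h1, map_sum, Finset.sum_apply]
  calc ∑ z ∈ S, (G.lazyOp ^ n) (F z • delta z) x ≤ ∑ z ∈ S, b * F z := by
        refine Finset.sum_le_sum fun z _ => ?_
        rw [map_smul, Pi.smul_apply, smul_eq_mul, mul_comm]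
        exact mul_le_mul_of_nonneg_right (hb z) (hF0 z)
    _ = b * ∑ z ∈ S, F z := by rw [Finset.mul_sum]
    _ ≤ b * ∑' y, F y := by
        gcongr
        exact hF.sum_le_tsum _ fun y _ => hF0 y

theorem MemDp.lpMem_lazyOp_sub (hdeg : ∀ x, (G.nbr x).Nonempty) {p : ℝ} (hp : 1 ≤ p) {g : X → ℝ}
    (hg : G.MemDp p g) : lpMem p (G.lazyOp g - g) := by
  have h := (hasSum_edge (ψ := fun x y => |g y - g x| ^ p) hg).summable
  refine Summable.of_nonneg_of_le (fun x => by positivity) (fun x => ?_) h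
  have hc : (1 : ℝ) ≤ (G.nbr x).card := by exact_mod_cast (hdeg x).card_pos
  have hc0 : (0 : ℝ) < (G.nbr x).card := by linarith
  have h1 : (G.lazyOp g - g) x = G.markov (fun y => g y - g x) x / 2 := by
    rw [Pi.sub_apply, lazyOp_apply, markov_apply, markov_apply, Finset.sum_sub_distrib,
      Finset.sum_const, nsmul_eq_mul]
    field_simp
    ring
  calc |(G.lazyOp g - g) x| ^ p ≤ |G.markov (fun y => g y - g x) x| ^ p := by
        rw [h1, abs_div, abs_two]
        gcongr
        linarith [abs_nonneg (G.markov (fun y => g y - g x) x)]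
    _ ≤ G.markov (fun y => |g y - g x| ^ p) x := abs_markov_rpow_le hdeg hp _ x
    _ ≤ ∑ y ∈ G.nbr x, |g y - g x| ^ p :=
        div_le_self (Finset.sum_nonneg fun _ _ => by positivity) hc

theorem memDp_of_lpMem {D : ℕ} (hval : G.BddVal D) {q : ℝ} (hq : 1 ≤ q) {f : X → ℝ}
    (hf : lpMem q f) : G.MemDp q f := by
  have h1 := summable_edge_fst hval hf
  have h2 := summable_edge_snd hval hf
  refine Summable.of_nonneg_of_le (fun e => by positivity) (fun e => ?_)
    (((h2.add h1).div_const 2).mul_left (2 ^ q))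
  simpa [grad, sub_eq_add_neg] using abs_add_rpow_le hq (f e.1.2) (-f e.1.1)

/-- Ultracontractivity of the lazy walk gives polynomial decay from `ℓ^p` to `ℓ^q`. -/
theorem exists_sum_lazyOp_pow_rpow_le {d : ℝ} (hd : 0 < d) (hIS : G.ISdim d) {D : ℕ} (hD : 0 < D)
    (hval : G.BddVal D) {p q : ℝ} (hp : 1 ≤ p) (hpq : p ≤ q) {h : X → ℝ} (hh : lpMem p h) :
    ∃ C : ℝ, 0 ≤ C ∧ ∀ (n : ℕ) (S : Finset X),
      ∑ x ∈ S, |(G.lazyOp ^ (n + n)) h x| ^ q ≤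
        (C * ((n : ℝ) + 1) ^ (-(d / 2 * (1 / p - 1 / q)))) ^ q := by
  have hdeg := hIS.nbr_nonempty
  obtain ⟨C, hC, hheat⟩ := exists_lazyOp_pow_delta_le hd hIS hD hval
  have hp0 : 0 < p := by linarith
  have hq0 : 0 < q := by linarith
  set F : X → ℝ := fun x => |h x| ^ p with hF
  have hF0 : 0 ≤ F := fun x => by positivity
  have hFs : Summable F := hh
  set T := ∑' x, F x with hT
  have hT0 : 0 ≤ T := tsum_nonneg hF0
  set r := q / p - 1 with hr
  have hr0 : 0 ≤ r := by
    rw [hr, sub_nonneg, one_le_div hp0]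
    exact hpq
  refine ⟨((C * T) ^ r * (D * T)) ^ (1 / q), by positivity, fun n S => ?_⟩
  set s : ℝ := ((n : ℝ) + 1) ^ (-(d / 2)) with hs
  have hs0 : 0 < s := by positivity
  have hL0 := lazyOp_pow_nonneg (G := G) (n + n) hF0
  have hsup : ∀ x, (G.lazyOp ^ (n + n)) F x ≤ C * s * T := fun x =>
    lazyOp_pow_le_of_delta_le (fun z => hheat z x n) (by positivity) hF0 hFs
  have hpt : ∀ x, |(G.lazyOp ^ (n + n)) h x| ^ q ≤
      (C * s * T) ^ r * (G.lazyOp ^ (n + n)) F x := by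
    intro x
    have hx0 : 0 ≤ (G.lazyOp ^ (n + n)) F x := hL0 x
    calc |(G.lazyOp ^ (n + n)) h x| ^ q = (|(G.lazyOp ^ (n + n)) h x| ^ p) ^ (r + 1) := by
          rw [← Real.rpow_mul (abs_nonneg _)]
          congr 1
          rw [hr]
          field_simp
          ring
      _ ≤ ((G.lazyOp ^ (n + n)) F x) ^ (r + 1) := by
          gcongr
          exact abs_lazyOp_pow_rpow_le hdeg hp _ h x
      _ = ((G.lazyOp ^ (n + n)) F x) ^ r * (G.lazyOp ^ (n + n)) F x := by
          rw [Real.rpow_add_of_nonneg hx0 hr0 zero_le_one, Real.rpow_one]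
      _ ≤ _ := by
          gcongr
          exact hsup x
  calc ∑ x ∈ S, |(G.lazyOp ^ (n + n)) h x| ^ q
      ≤ ∑ x ∈ S, (C * s * T) ^ r * (G.lazyOp ^ (n + n)) F x := Finset.sum_le_sum fun x _ => hpt x
    _ = (C * s * T) ^ r * ∑ x ∈ S, (G.lazyOp ^ (n + n)) F x := by rw [Finset.mul_sum]
    _ ≤ (C * s * T) ^ r * (D * T) := by
        gcongr
        exact sum_lazyOp_pow_le hdeg hval hF0 hFs (n + n) S
    _ = ((C * T) ^ r * (D * T)) * s ^ r := by
        rw [mul_right_comm C s T, Real.mul_rpow (by positivity) hs0.le]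
        ring
    _ = _ := by
        have hQ : 0 ≤ (C * T) ^ r * (D * T) := by positivity
        rw [Real.mul_rpow (Real.rpow_nonneg hQ _) (by positivity), ← Real.rpow_mul hQ,
          one_div_mul_cancel hq0.ne', Real.rpow_one, hs, ← Real.rpow_mul (by positivity),
          ← Real.rpow_mul (by positivity)]
        congr 2
        rw [hr]
        field_simp

end LFGraph

/-- for a graph with `IS_d`, `1 ≤ p < d/2`, `g ∈ D^p(Γ)` and `g̃`
its boundary value for the simple random walk, one has `g̃ - g ∈ ℓ^q(X)` for all
`q > dp/(d-2p)`; in particular `g̃ ∈ D^q(Γ)` and `g̃`, `g` define the same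
unreduced `ℓ^q`-cohomology class. -/
theorem stmt16 {X : Type*} (G : LFGraph X) (hconn : G.Conn) (D : ℕ) (hval : G.BddVal D)
    (d p : ℝ) (hIS : G.ISdim d) (hp1 : 1 ≤ p) (hp2 : p < d / 2)
    (g : X → ℝ) (hg : G.MemDp p g) (gt : X → ℝ)
    (hbv : ∀ x : X, Filter.Tendsto (fun n => G.avg n g x) Filter.atTop (nhds (gt x)))
    (q : ℝ) (hq : d * p / (d - 2 * p) < q) :
    lpMem q (fun x => gt x - g x) ∧ G.MemDp q gt ∧
    ∃ (f : X → ℝ) (c : ℝ), lpMem q f ∧ ∀ x, gt x = g x + f x + c := by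
  have hp0 : 0 < p := by linarith
  have hd : 0 < d := by linarith
  have hd2p : 0 < d - 2 * p := by linarith
  have hpq : p < q := by
    refine lt_of_le_of_lt ?_ hq
    rw [le_div_iff₀ hd2p]
    nlinarith
  have hq1 : 1 ≤ q := by linarith
  have hq0 : 0 < q := by linarith
  have hdeg := hIS.nbr_nonempty
  have hval' : G.BddVal (D + 1) := fun x => (hval x).trans D.le_succ
  have hexp : 1 < d / 2 * (1 / p - 1 / q) := by
    rw [div_lt_iff₀ hd2p] at hq
    have h1 : d / 2 * (1 / p - 1 / q) = d * (q - p) / (2 * p * q) := by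
      field_simp
    rw [h1, one_lt_div (by positivity)]
    linarith
  set h : X → ℝ := (G.lazyOp ^ 2) g - g with hh
  have hlp : lpMem p h := by
    have h1 := hg.lpMem_lazyOp_sub hdeg hp1
    have h2 := (LFGraph.lpMem_lazyOp hdeg hval hp1 h1).add hp1 h1
    have h3 : h = fun x => G.lazyOp (G.lazyOp g - g) x + (G.lazyOp g - g) x := by
      ext x
      rw [hh, map_sub, sq, Module.End.mul_apply]
      simp
    rwa [h3]
  obtain ⟨C, hC, hbound⟩ := LFGraph.exists_sum_lazyOp_pow_rpow_le hd hIS D.succ_pos hval' hp1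
    hpq.le hlp
  have hsummable : Summable fun k : ℕ => C * ((k : ℝ) + 1) ^ (-(d / 2 * (1 / p - 1 / q))) := by
    refine Summable.mul_left C ?_
    refine ((Real.summable_one_div_nat_add_rpow 1 _).mpr hexp).congr fun k => ?_
    have hk : (0 : ℝ) ≤ (k : ℝ) + 1 := by positivity
    rw [abs_of_nonneg hk, Real.rpow_neg hk, one_div]
  have htel : ∀ N : ℕ,
      ∑ k ∈ Finset.range N, (G.lazyOp ^ (k + k)) h = (G.lazyOp ^ (N + N)) g - g := by
    intro N
    have h1 : ∀ k, (G.lazyOp ^ (k + k)) h =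
        (G.lazyOp ^ (k + 1 + (k + 1))) g - (G.lazyOp ^ (k + k)) g := by
      intro k
      rw [hh, map_sub, ← Module.End.mul_apply, ← pow_add]
      congr 3
      ring
    simp_rw [h1]
    rw [Finset.sum_range_sub fun k => (G.lazyOp ^ (k + k)) g]
    simp
  have hw : lpMem q fun x => gt x - g x := by
    refine lpMem_of_tendsto_sum hq1 (fun k => by positivity) hsummable hbound fun x => ?_
    have h1 : Tendsto (fun N : ℕ => N + N) atTop atTop :=
      tendsto_atTop_mono (fun N => Nat.le_add_left N N) tendsto_id
    refine (((LFGraph.tendsto_lazyOp_pow (hbv x)).comp h1).sub_const (g x)).congr fun N => ?_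
    have h2 := congrFun (htel N) x
    rw [Finset.sum_apply] at h2
    rw [h2]
    rfl
  refine ⟨hw, ?_, _, 0, hw, fun x => by ring⟩
  have h1 : lpMem q fun e => G.grad (fun x => gt x - g x) e + G.grad g e :=
    lpMem.add hq1 (LFGraph.memDp_of_lpMem hval hq1 hw) (lpMem.of_le hp0 hpq.le hg)
  have h2 : (fun e => G.grad (fun x => gt x - g x) e + G.grad g e) = G.grad gt := by
    ext e
    simp only [LFGraph.grad]
    ring
  rwa [h2] at h1
end

section
/- Let Γ be a connected graph of bounded valency. Then the reduced ℓ^1-cohomology of Γ in degree one is trivial (D^1(Γ) equals the D^1-closure of ℓ^1(X) + ℝ·1) if and only if Γ has at most one end. -/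
open scoped BigOperators ENNReal NNReal
open Filter Topology

namespace LFGraph

variable {X : Type*}

lemma summable_abs_of_lpMem_one {ι : Type*} {f : ι → ℝ} (hf : lpMem 1 f) :
    Summable fun i => |f i| := by
  simpa [lpMem] using hf

lemma gradNorm_one (G : LFGraph X) (g : X → ℝ) :
    G.gradNorm 1 g = ∑' e : G.Edge, |G.grad g e| := by
  simp [gradNorm]

lemma reachAvoid.symm {G : LFGraph X} {F : Finset X} {u v : X} (h : G.reachAvoid F u v) :
    G.reachAvoid F v u := by
  induction h with
  | refl => exact .refl
  | tail _ hbc ih => exact .head ⟨(G.symm _ _).1 hbc.1, hbc.2.2, hbc.2.1⟩ ih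

lemma Conn.reachAvoid_empty {G : LFGraph X} (hG : G.Conn) (u v : X) : G.reachAvoid ∅ u v :=
  Relation.ReflTransGen.mono (fun _ _ hab => ⟨hab, by simp, by simp⟩) _ _ (hG u v)

/-- The subgraph of `G` induced on the complement of `F`. -/
def avoidGraph (G : LFGraph X) (F : Finset X) : SimpleGraph X where
  Adj a b := b ∈ G.nbr a ∧ a ∉ F ∧ b ∉ F
  symm := ⟨fun _ _ ⟨hab, ha, hb⟩ => ⟨(G.symm _ _).1 hab, hb, ha⟩⟩
  loopless := ⟨fun a h => G.loopless a h.1⟩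

lemma exists_finset_edge_of_isPath (G : LFGraph X) (F : Finset X) (g : X → ℝ) {u v : X}
    (p : (G.avoidGraph F).Walk u v) (hp : p.IsPath) :
    ∃ P : Finset G.Edge, (∀ e ∈ P, e.1.1 ∈ p.support ∧ e.1.1 ∉ F) ∧
      |g v - g u| ≤ ∑ e ∈ P, |G.grad g e| := by
  classical
  induction p with
  | nil => exact ⟨∅, by simp, by simp⟩
  | @cons a b c hab p ih =>
    rw [SimpleGraph.Walk.cons_isPath_iff] at hp
    obtain ⟨P, hP, hle⟩ := ih hp.1
    let e : G.Edge := ⟨(a, b), hab.1⟩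
    have he : e ∉ P := fun h => hp.2 (hP e h).1
    refine ⟨insert e P, ?_, ?_⟩
    · intro e' he'
      rcases Finset.mem_insert.1 he' with rfl | he'
      · exact ⟨by simp [e], hab.2.1⟩
      · exact ⟨by simp [(hP e' he').1], (hP e' he').2⟩
    · rw [Finset.sum_insert he]
      have htri := abs_sub_le (g c) (g b) (g a)
      have hgrad : G.grad g e = g b - g a := rfl
      rw [hgrad]
      linarith

/-- The oscillation of `g` between two vertices joined outside `F` is controlled by the gradient
on finitely many edges issuing from the complement of `F`. -/
lemma reachAvoid.exists_finset_edge {G : LFGraph X} {F : Finset X} {u v : X}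
    (h : G.reachAvoid F u v) (g : X → ℝ) :
    ∃ P : Finset G.Edge, (∀ e ∈ P, e.1.1 ∉ F) ∧ |g v - g u| ≤ ∑ e ∈ P, |G.grad g e| := by
  classical
  have hr : (G.avoidGraph F).Reachable u v := by
    rw [SimpleGraph.reachable_iff_reflTransGen]
    exact h
  obtain ⟨p, hp⟩ := hr.exists_isPath
  obtain ⟨P, hP, hle⟩ := G.exists_finset_edge_of_isPath F g p hp
  exact ⟨P, fun e he => (hP e he).2, hle⟩

lemma Conn.abs_sub_le_gradNorm_one {G : LFGraph X} (hG : G.Conn) {g : X → ℝ}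
    (hg : G.MemDp 1 g) (u v : X) : |g v - g u| ≤ G.gradNorm 1 g := by
  obtain ⟨P, -, hle⟩ := (hG.reachAvoid_empty u v).exists_finset_edge g
  rw [gradNorm_one]
  exact hle.trans ((summable_abs_of_lpMem_one hg).sum_le_tsum P fun _ _ => abs_nonneg _)

lemma Conn.exists_reachAvoid_nbr {G : LFGraph X} (hG : G.Conn) {F : Finset X} {w x : X}
    (hw : w ∈ F) (hx : x ∉ F) :
    ∃ a ∈ F, ∃ b ∈ G.nbr a, G.reachAvoid F x b := by
  suffices h : ∀ z, Relation.ReflTransGen G.Adj x z →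
      G.reachAvoid F x z ∧ z ∉ F ∨ ∃ a ∈ F, ∃ b ∈ G.nbr a, G.reachAvoid F x b by
    exact (h w (hG x w)).resolve_left fun h => h.2 hw
  intro z hz
  induction hz with
  | refl => exact Or.inl ⟨.refl, hx⟩
  | @tail b c _ hbc ih =>
    rcases ih with ⟨hxb, hb⟩ | ih
    · by_cases hc : c ∈ F
      · exact Or.inr ⟨c, hc, b, (G.symm _ _).1 hbc, hxb⟩
      · exact Or.inl ⟨hxb.tail ⟨hbc, hb, hc⟩, hc⟩
    · exact Or.inr ih

/-- An infinite set of vertices meets an infinite component of the complement of `F`. -/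
lemma Conn.exists_infinite_reachAvoid {G : LFGraph X} (hG : G.Conn) {F : Finset X}
    (hF : F.Nonempty) {S : Set X} (hS : S.Infinite) :
    ∃ s ∈ S, s ∉ F ∧ {z | G.reachAvoid F s z}.Infinite := by
  classical
  obtain ⟨w, hw⟩ := hF
  by_contra! hfin
  refine hS ?_
  refine (F.finite_toSet.union ((F.biUnion G.nbr).finite_toSet.biUnion
    (t := fun b => {x ∈ S \ F | G.reachAvoid F x b}) fun b _ => ?_)).subset ?_
  · rcases Set.eq_empty_or_nonempty {x ∈ S \ F | G.reachAvoid F x b} with h | ⟨s, hs, hsb⟩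
    · rw [h]
      exact Set.finite_empty
    · exact (hfin s hs.1 hs.2).subset fun x hx =>
        Relation.ReflTransGen.trans hsb (reachAvoid.symm hx.2)
  · intro x hx
    by_cases hxF : x ∈ F
    · exact Or.inl hxF
    · obtain ⟨a, ha, b, hb, hxb⟩ := hG.exists_reachAvoid_nbr hw hxF
      exact Or.inr (Set.mem_biUnion (Finset.mem_coe.2 (Finset.mem_biUnion.2 ⟨a, ha, hb⟩))
        ⟨⟨hx, hxF⟩, hxb⟩)

/-- On a graph with at most one end, functions with summable gradient converge at infinity. -/
lemma AtMostOneEnd.exists_tendsto_cofinite {G : LFGraph X} (hend : G.AtMostOneEnd)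
    (hG : G.Conn) (e0 : X) {g : X → ℝ} (hg : G.MemDp 1 g) :
    ∃ c : ℝ, Tendsto g cofinite (𝓝 c) := by
  classical
  rcases finite_or_infinite X with hX | hX
  · exact ⟨0, by simp [Filter.cofinite_eq_bot]⟩
  have hbdd : Set.range g ⊆ Metric.closedBall (g e0) (G.gradNorm 1 g) := by
    rintro _ ⟨x, rfl⟩
    exact hG.abs_sub_le_gradNorm_one hg e0 x
  obtain ⟨c, -, hc⟩ := (isCompact_closedBall (g e0) (G.gradNorm 1 g)).exists_mapClusterPt
    (f := cofinite) (u := g) (tendsto_principal.2 (Eventually.of_forall fun x => hbdd ⟨x, rfl⟩))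
  refine ⟨c, Metric.tendsto_nhds.2 fun ε hε => ?_⟩
  have hT : {x | dist (g x) c < ε / 2}.Infinite :=
    Filter.frequently_cofinite_iff_infinite.1
      (hc.frequently (Metric.ball_mem_nhds c (half_pos hε)))
  obtain ⟨K, hK⟩ := summable_iff_vanishing_norm.1 (summable_abs_of_lpMem_one hg) (ε / 2)
    (half_pos hε)
  let F : Finset X := insert e0 (K.image fun e => e.1.1)
  have hF : F.Nonempty := Finset.insert_nonempty _ _
  rw [Filter.eventually_cofinite]
  by_contra hS
  obtain ⟨s, hs, hsF, hs'⟩ := hG.exists_infinite_reachAvoid hF hS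
  obtain ⟨t, ht, htF, ht'⟩ := hG.exists_infinite_reachAvoid hF hT
  obtain ⟨P, hP, hle⟩ := (hend F s t hsF htF hs' ht').symm.exists_finset_edge g
  have hdisj : Disjoint P K := Finset.disjoint_left.2 fun e heP heK =>
    hP e heP (Finset.mem_insert_of_mem (Finset.mem_image_of_mem _ heK))
  have hsmall := (le_abs_self _).trans_lt (hK P hdisj)
  refine hs ?_
  have htri := dist_triangle (g s) (g t) c
  rw [Real.dist_eq (g s) (g t)] at htri
  simp only [Set.mem_ofPred_eq] at ht
  linarith

lemma abs_clamp_sub_clamp_le (r a b : ℝ) :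
    |max (-r) (min r a) - max (-r) (min r b)| ≤ |a - b| := by
  have h1 := abs_max_sub_max_le_abs (min r a) (min r b) (-r)
  have h2 := abs_min_sub_min_le_max r a r b
  rw [max_comm (-r), max_comm (-r)]
  exact h1.trans (h2.trans (by simp))

lemma abs_clamp_le {r : ℝ} (hr : 0 ≤ r) (a : ℝ) : |max (-r) (min r a)| ≤ r :=
  abs_le.2 ⟨le_max_left _ _, max_le (by linarith) (min_le_left _ _)⟩

/-- A function with summable gradient that converges at infinity is a limit of finitely supported
functions plus constants. -/
lemma inClos_one_of_tendsto_cofinite {G : LFGraph X} (e0 : X) {g : X → ℝ} (hg : G.MemDp 1 g)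
    {c : ℝ} (hc : Tendsto g cofinite (𝓝 c)) : G.InClos 1 e0 g := by
  intro ε hε
  let t : ℝ → X → ℝ := fun r x => max (-r) (min r (g x - c))
  have hsum := summable_abs_of_lpMem_one hg
  have hbound : ∀ r e, |G.grad (t r) e| ≤ |G.grad g e| := fun r e => by
    simpa [grad] using abs_clamp_sub_clamp_le r (g e.1.2 - c) (g e.1.1 - c)
  have hsmall : ∀ r, 0 ≤ r → ∀ e, |G.grad (t r) e| ≤ 2 * r := fun r hr e => by
    have h := abs_sub (t r e.1.2) (t r e.1.1)
    have h1 : |t r e.1.2| ≤ r := abs_clamp_le hr _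
    have h2 : |t r e.1.1| ≤ r := abs_clamp_le hr _
    simp only [grad]
    linarith
  have hlim : Tendsto (fun n : ℕ => (∑' e, |G.grad (t (1 / ((n : ℝ) + 1))) e|)
      + 1 / ((n : ℝ) + 1)) atTop (𝓝 0) := by
    have h0 : Tendsto (fun n : ℕ => 1 / ((n : ℝ) + 1)) atTop (𝓝 0) :=
      tendsto_one_div_add_atTop_nhds_zero_nat
    have h1 : Tendsto (fun n : ℕ => ∑' e, |G.grad (t (1 / ((n : ℝ) + 1))) e|) atTop
        (𝓝 (∑' _ : G.Edge, (0 : ℝ))) := by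
      refine tendsto_tsum_of_dominated_convergence hsum (fun e => ?_)
        (Eventually.of_forall fun n e => ?_)
      · refine squeeze_zero (fun _ => abs_nonneg _) (fun n => hsmall _ (by positivity) e) ?_
        simpa using h0.const_mul 2
      · simpa using hbound _ e
    simpa using h1.add h0
  obtain ⟨n, hn⟩ := (hlim.eventually (gt_mem_nhds hε)).exists
  have hr : (0 : ℝ) < 1 / ((n : ℝ) + 1) := by positivity
  generalize 1 / ((n : ℝ) + 1) = r at hn hr
  have hdiff : (fun x => g x - ((g x - c - t r x) + c)) = t r := by
    funext x
    ring
  refine ⟨fun x => g x - c - t r x, c, ?_, ?_, ?_⟩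
  · refine summable_of_hasFiniteSupport ?_
    have hfin : {x | ¬ dist (g x) c < r}.Finite :=
      Filter.eventually_cofinite.1 (Metric.tendsto_nhds.1 hc r hr)
    refine hfin.subset fun x hx hlt => hx ?_
    rw [Real.dist_eq, abs_lt] at hlt
    simp [t, min_eq_right hlt.2.le, max_eq_right hlt.1.le]
  · rw [hdiff]
    simpa [MemDp, lpMem] using
      Summable.of_nonneg_of_le (fun _ => abs_nonneg _) (hbound r) hsum
  · have he0 : |g e0 - ((g e0 - c - t r e0) + c)| ≤ r := by
      rw [congrFun hdiff e0]
      exact abs_clamp_le hr.le _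
    rw [dpDist, hdiff, gradNorm_one]
    linarith

/-- The indicator function of a component of the complement of a finite set has summable
gradient. -/
lemma memDp_one_indicator_reachAvoid (G : LFGraph X) (F : Finset X) (x : X) :
    G.MemDp 1 ({z | G.reachAvoid F x z}.indicator 1) := by
  classical
  let N : Finset X := F ∪ F.biUnion G.nbr
  refine summable_of_hasFiniteSupport ?_
  refine (((N ×ˢ N).finite_toSet).preimage
    (f := (Subtype.val : G.Edge → X × X)) Subtype.val_injective.injOn).subset ?_
  rintro ⟨⟨a, b⟩, hab : b ∈ G.nbr a⟩ hne
  have hba := (G.symm _ _).1 hab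
  suffices h : a ∈ F ∨ b ∈ F by
    rcases h with h | h
    · have hN : a ∈ N ∧ b ∈ N := ⟨Finset.mem_union_left _ h,
        Finset.mem_union_right _ (Finset.mem_biUnion.2 ⟨a, h, hab⟩)⟩
      simpa using hN
    · have hN : a ∈ N ∧ b ∈ N :=
        ⟨Finset.mem_union_right _ (Finset.mem_biUnion.2 ⟨b, h, hba⟩), Finset.mem_union_left _ h⟩
      simpa using hN
  by_contra! h
  refine hne ?_
  have hiff : G.reachAvoid F x a ↔ G.reachAvoid F x b :=
    ⟨fun hr => hr.tail ⟨hab, h.1, h.2⟩, fun hr => hr.tail ⟨hba, h.2, h.1⟩⟩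
  simp [grad, Set.indicator_apply, hiff]

lemma _root_.Set.Infinite.exists_abs_lt_of_lpMem_one {f : X → ℝ} {S : Set X} (hS : S.Infinite)
    (hf : lpMem 1 f) {ε : ℝ} (hε : 0 < ε) : ∃ s ∈ S, |f s| < ε := by
  have hlim := (summable_abs_of_lpMem_one hf).tendsto_cofinite_zero
  have hfin := Filter.eventually_cofinite.1 (hlim.eventually (gt_mem_nhds hε))
  by_contra! h
  exact hS (hfin.subset fun s hs => not_lt.2 (h s hs))

lemma Conn.atMostOneEnd_of_inClos_one {G : LFGraph X} (hG : G.Conn) (e0 : X)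
    (h : ∀ g : X → ℝ, G.MemDp 1 g → G.InClos 1 e0 g) : G.AtMostOneEnd := by
  classical
  intro F x y hx hy hxinf hyinf
  by_contra hxy
  obtain ⟨f, c, hf, hmem, hdist⟩ :=
    h _ (G.memDp_one_indicator_reachAvoid F x) (1 / 2) (by norm_num)
  obtain ⟨a, ha, hfa⟩ := hxinf.exists_abs_lt_of_lpMem_one hf (ε := 1 / 4) (by norm_num)
  obtain ⟨b, hb, hfb⟩ := hyinf.exists_abs_lt_of_lpMem_one hf (ε := 1 / 4) (by norm_num)
  have hb' : b ∉ {z | G.reachAvoid F x z} := fun hxb =>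
    hxy (Relation.ReflTransGen.trans hxb (reachAvoid.symm hb))
  have hle := (le_abs_self _).trans (hG.abs_sub_le_gradNorm_one hmem b a)
  have hpos := abs_nonneg ({z | G.reachAvoid F x z}.indicator (1 : X → ℝ) e0 - (f e0 + c))
  simp only [dpDist] at hdist
  rw [Set.indicator_of_mem ha, Set.indicator_of_notMem hb', Pi.one_apply] at hle
  rw [abs_lt] at hfa hfb
  linarith

end LFGraph

/-- the reduced `ℓ^1`-cohomology in degree one of a connected graph
of bounded valency is trivial if and only if the graph has at most one end. -/
theorem stmt18 {X : Type*} (G : LFGraph X) (hconn : G.Conn) (D : ℕ) (hval : G.BddVal D)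
    (e0 : X) :
    (∀ g : X → ℝ, G.MemDp 1 g → G.InClos 1 e0 g) ↔ LFGraph.AtMostOneEnd G := by
  refine ⟨hconn.atMostOneEnd_of_inClos_one e0, fun hend g hg => ?_⟩
  obtain ⟨c, hc⟩ := hend.exists_tendsto_cofinite hconn e0 hg
  exact LFGraph.inClos_one_of_tendsto_cofinite e0 hg hc
end

section
/- Let Γ be an infinite connected graph of bounded valency. Then the reduced ℓ^∞-cohomology of Γ in degree one is non-trivial. Concretely, fixing a vertex r and letting g(x) = d(x, r) be the graph distance to r, one has g ∈ D^∞(Γ), and every h : X → ℝ with ‖∇(g − h)‖_{ℓ^∞(E)} < 1/2 is unbounded; hence g does not lie in the D^∞-closure of ℓ^∞(X) + ℝ·1. -/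
open scoped BigOperators ENNReal NNReal
open Filter Topology

namespace LFGraph

variable {X : Type*} {G : LFGraph X}

theorem reachN_snoc {n : ℕ} {x y z : X} (h : G.reachN n x y) (hz : z ∈ G.nbr y) :
    G.reachN (n + 1) x z := by
  induction n generalizing x with
  | zero =>
    obtain rfl : y = x := h
    exact ⟨z, hz, rfl⟩
  | succ n ih =>
    obtain ⟨w, hw, h⟩ := h
    exact ⟨w, hw, ih h⟩

theorem Conn.exists_reachN (hG : G.Conn) (x y : X) : ∃ n, G.reachN n x y := by
  induction hG x y with
  | refl => exact ⟨0, rfl⟩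
  | tail _ hz ih =>
    obtain ⟨n, hn⟩ := ih
    exact ⟨n + 1, reachN_snoc hn hz⟩

theorem Conn.reachN_gdist (hG : G.Conn) (x y : X) : G.reachN (G.gdist x y) x y :=
  Nat.sInf_mem (hG.exists_reachN x y)

theorem Conn.gdist_le_succ (hG : G.Conn) (r : X) {x y : X} (h : y ∈ G.nbr x) :
    G.gdist r y ≤ G.gdist r x + 1 :=
  Nat.sInf_le (reachN_snoc (hG.reachN_gdist r x) h)

theorem finite_setOf_reachN (n : ℕ) (x : X) : {y | G.reachN n x y}.Finite := by
  induction n generalizing x with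
  | zero => exact Set.finite_singleton x
  | succ n ih =>
    refine ((G.nbr x).finite_toSet.biUnion fun z _ => ih z).subset ?_
    rintro y ⟨z, hz, h⟩
    exact Set.mem_biUnion (Finset.mem_coe.2 hz) h

theorem Conn.exists_lt_gdist [Infinite X] (hG : G.Conn) (r : X) (n : ℕ) :
    ∃ x, n < G.gdist r x := by
  by_contra! h
  refine Set.infinite_univ (α := X)
    (((Set.finite_Iic n).biUnion fun k _ => finite_setOf_reachN (G := G) k r).subset ?_)
  intro x _
  exact Set.mem_biUnion (Set.mem_Iic.2 (h x)) (hG.reachN_gdist r x)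

theorem abs_sub_le_of_reachN {u : X → ℝ} {c : ℝ} (hu : ∀ e : G.Edge, |G.grad u e| ≤ c)
    {n : ℕ} {x y : X} (h : G.reachN n x y) : |u y - u x| ≤ n * c := by
  induction n generalizing x with
  | zero =>
    obtain rfl : y = x := h
    simp
  | succ n ih =>
    obtain ⟨z, hz, h⟩ := h
    have hxz : |u z - u x| ≤ c := hu ⟨(x, z), hz⟩
    have := abs_sub_le (u y) (u z) (u x)
    push_cast
    linarith [ih h]

theorem Conn.abs_grad_gdist_le_one (hG : G.Conn) (r : X) (e : G.Edge) :
    |G.grad (fun x => (G.gdist r x : ℝ)) e| ≤ 1 := by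
  obtain ⟨⟨x, y⟩, h⟩ := e
  have hxy : (G.gdist r y : ℝ) ≤ G.gdist r x + 1 := mod_cast hG.gdist_le_succ r h
  have hyx : (G.gdist r x : ℝ) ≤ G.gdist r y + 1 :=
    mod_cast hG.gdist_le_succ r ((G.symm x y).1 h)
  simp only [grad]
  rw [abs_le]
  constructor <;> linarith

theorem Conn.not_boundedFun_of_iSup_lt [Infinite X] (hG : G.Conn) (r : X) {h : X → ℝ}
    (hh : (⨆ e : G.Edge,
      (‖G.grad (fun x => (G.gdist r x : ℝ)) e - G.grad h e‖₊ : ℝ≥0∞)) < 1 / 2) :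
    ¬ BoundedFun h := by
  rintro ⟨M, hM⟩
  have hu : ∀ e : G.Edge, |G.grad (fun x => (G.gdist r x : ℝ) - h x) e| ≤ 1 / 2 := by
    intro e
    have he := (le_iSup (fun e : G.Edge =>
      (‖G.grad (fun x => (G.gdist r x : ℝ)) e - G.grad h e‖₊ : ℝ≥0∞)) e).trans hh.le
    have h2 : (1 / 2 : ℝ≥0∞) = ((1 / 2 : ℝ≥0) : ℝ≥0∞) := by
      rw [ENNReal.coe_div two_ne_zero]
      norm_num
    rw [h2, ENNReal.coe_le_coe, ← NNReal.coe_le_coe, coe_nnnorm, Real.norm_eq_abs] at he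
    convert he using 2
    · simp only [grad]
      ring
    · norm_num
  obtain ⟨n, hn⟩ := exists_nat_gt (4 * M + 2 * G.gdist r r)
  obtain ⟨x, hx⟩ := hG.exists_lt_gdist r n
  have hx' : (n : ℝ) < G.gdist r x := mod_cast hx
  have := (abs_le.1 (abs_sub_le_of_reachN hu (hG.reachN_gdist r x))).2
  have := (abs_le.1 (hM x)).2
  have := (abs_le.1 (hM r)).1
  linarith

end LFGraph

/-- for an infinite connected graph of bounded valency, the
distance function `g = d(·, r)` lies in `D^∞(Γ)`, every `h` with
`‖∇(g - h)‖_{ℓ^∞(E)} < 1/2` is unbounded, and consequently `g` does not lie in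
the `D^∞`-closure of `ℓ^∞(X) + ℝ·1`; so reduced `ℓ^∞`-cohomology is non-trivial. -/
theorem stmt19 {X : Type*} [Infinite X] (G : LFGraph X) (hconn : G.Conn)
    (D : ℕ) (hval : G.BddVal D) (r e0 : X) :
    (∀ e : G.Edge, |G.grad (fun x => (G.gdist r x : ℝ)) e| ≤ 1) ∧
    (∀ h : X → ℝ,
      (⨆ e : G.Edge, (‖G.grad (fun x => (G.gdist r x : ℝ)) e - G.grad h e‖₊ : ℝ≥0∞)) < 1 / 2 →
      ¬ BoundedFun h) ∧
    ¬ (∀ ε : ℝ, 0 < ε → ∃ f : X → ℝ, BoundedFun f ∧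
      (⨆ e : G.Edge, (‖G.grad (fun x => (G.gdist r x : ℝ) - f x) e‖₊ : ℝ≥0∞))
        + (‖(G.gdist r e0 : ℝ) - f e0‖₊ : ℝ≥0∞) < ENNReal.ofReal ε) := by
  refine ⟨hconn.abs_grad_gdist_le_one r, fun h => hconn.not_boundedFun_of_iSup_lt r, ?_⟩
  intro H
  obtain ⟨f, hf, hlt⟩ := H (1 / 2) (by norm_num)
  refine hconn.not_boundedFun_of_iSup_lt r ?_ hf
  have h2 : ENNReal.ofReal (1 / 2) = 1 / 2 := by
    rw [ENNReal.ofReal_div_of_pos two_pos]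
    simp
  rw [h2] at hlt
  convert lt_of_le_of_lt le_self_add hlt using 6
  simp only [LFGraph.grad]
  ring
end
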